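/- arXiv:2511.07589 — 3 statements merged into one kernel-verified Lean document; each statement's English description precedes it below -/
import Mathlib

section
/- Let A be a commutative Noetherian ring, and let I ⊂ A be a local complete intersection ideal of height n. Then I is a complete intersection ideal (i.e., generated by a regular sequence of length n) if and only if I can be generated by n elements. -/
/-- The height of an ideal `I`: the infimum of the heights of the prime ideals
containing `I` (computed in the prime spectrum). -/
noncomputable def idealHeight {A : Type*} [CommRing A] (I : Ideal A) : ℕ∞ :=
  ⨅ (p : PrimeSpectrum A) (_ : I ≤ p.asIdeal), Order.height p

/-- `I` is a local complete intersection ideal of height `n`: `I` has height `n`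
and, for every prime ideal `P ⊇ I`, the ideal `I · A_P` of the localization `A_P`
is generated by a regular sequence of length `n`. -/
def IsLocalCompleteIntersectionOfHeight {A : Type*} [CommRing A] (I : Ideal A) (n : ℕ) : Prop :=
  idealHeight I = n ∧
  ∀ (P : Ideal A) [P.IsPrime], I ≤ P →
    ∃ rs : List (Localization.AtPrime P),
      rs.length = n ∧ RingTheory.Sequence.IsRegular (Localization.AtPrime P) rs ∧
      Ideal.ofList rs = I.map (algebraMap A (Localization.AtPrime P))

open CategoryTheory Abelian RingTheory.Sequence TensorProduct

universe u

theorem coset_avoid {R : Type*} [CommRing R] (S : Set (Ideal R)) (hS : S.Finite)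
    (hp : ∀ p ∈ S, p.IsPrime) (x : R) (J : Ideal R) (h : ∀ p ∈ S, x ∈ p → ¬ J ≤ p) :
    ∃ j ∈ J, ∀ p ∈ S, x + j ∉ p := by
  classical
  let T : Set (Ideal R) := {p | Maximal (· ∈ S) p ∧ x ∈ p}
  let T' : Set (Ideal R) := {p | Maximal (· ∈ S) p ∧ x ∉ p}
  have hT : T.Finite := hS.subset fun p hp => hp.1.prop
  have hT' : T'.Finite := hS.subset fun p hp => hp.1.prop
  let K : Ideal R := J ⊓ hT'.toFinset.inf id
  have hK : ¬ ((K : Set R) ⊆ ⋃ i ∈ T, ((i : Ideal R) : Set R)) := by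
    intro hsub
    obtain ⟨p, hpT, hle⟩ := (Ideal.subset_union_prime_finite hT (f := fun i => i) ⊥ ⊥
      (fun i hi _ _ => hp i hi.1.prop)).mp hsub
    have hpp : p.IsPrime := hp p hpT.1.prop
    rcases hpp.inf_le.mp hle with h1 | h1
    · exact h p hpT.1.prop hpT.2 h1
    · obtain ⟨q, hq, hqp⟩ := hpp.inf_le'.mp h1
      rw [Set.Finite.mem_toFinset] at hq
      have := hq.1.eq_of_le hpT.1.prop hqp
      exact hq.2 (by rw [this]; exact hpT.2)
  obtain ⟨j, hjK, hj⟩ := Set.not_subset.mp hK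
  refine ⟨j, hjK.1, fun p hpS hmem => ?_⟩
  obtain ⟨q, hpq, hq⟩ := hS.exists_le_maximal hpS
  have hmem' := hpq hmem
  by_cases hx : x ∈ q
  · apply hj
    simp only [Set.mem_iUnion]
    exact ⟨q, ⟨hq, hx⟩, (Ideal.add_mem_iff_right q hx).mp hmem'⟩
  · have : hT'.toFinset.inf id ≤ q :=
      Finset.inf_le (f := id) (hT'.mem_toFinset.mpr ⟨hq, hx⟩)
    exact hx ((Ideal.add_mem_iff_left q (this hjK.2)).mp hmem')

/-- Vanishing of `Ext^i(R/I, M)` for `i < n`. -/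
def ExtVan {R : Type u} [CommRing R] (I : Ideal R) (M : Type u) [AddCommGroup M] [Module R M]
    (n : ℕ) : Prop :=
  ∀ i < n, Subsingleton (Ext (ModuleCat.of R (R ⧸ I)) (ModuleCat.of R M) i)

theorem ExtVan.congr {R : Type u} [CommRing R] {I : Ideal R} {M M' : Type u} [AddCommGroup M]
    [Module R M] [AddCommGroup M'] [Module R M'] {n : ℕ} (h : ExtVan I M n) (e : M ≃ₗ[R] M') :
    ExtVan I M' n := by
  intro i hi
  have : Subsingleton ((extFunctorObj (ModuleCat.of R (R ⧸ I)) i).obj (ModuleCat.of R M)) := h i hi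
  let f := (extFunctorObj (ModuleCat.of R (R ⧸ I)) i).mapIso e.toModuleIso
  exact (f.addCommGroupIsoToAddEquiv.symm.toEquiv).subsingleton

theorem ExtVan.quot {R : Type u} [CommRing R] {I : Ideal R} {M : Type u} [AddCommGroup M]
    [Module R M] {n : ℕ} (h : ExtVan I M (n + 1)) {g : R} (hg : IsSMulRegular M g) :
    ExtVan I (QuotSMulTop g M) n := by
  intro i hi
  have zero1 := AddCommGrpCat.isZero_of_iff_subsingleton.mpr (h i (by omega))
  have zero2 := AddCommGrpCat.isZero_of_iff_subsingleton.mpr (h (i + 1) (by omega))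
  have hg' : IsSMulRegular (ModuleCat.of R M) g := hg
  exact AddCommGrpCat.subsingleton_of_isZero <| ShortComplex.Exact.isZero_of_both_zeros
    ((Ext.covariant_sequence_exact₃' (ModuleCat.of R (R ⧸ I))
      hg'.smulShortComplex_shortExact) i (i + 1) rfl)
    (zero1.eq_zero_of_src _) (zero2.eq_zero_of_tgt _)

theorem ExtVan.eq_zero {R : Type u} [CommRing R] {I : Ideal R} {M : Type u} [AddCommGroup M]
    [Module R M] {n : ℕ} (h : ExtVan I M (n + 1)) (m : M) (hm : ∀ r ∈ I, r • m = 0) : m = 0 := by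
  have := h 0 (by omega)
  have : Subsingleton (ModuleCat.of R (R ⧸ I) ⟶ ModuleCat.of R M) :=
    Ext.addEquiv₀.subsingleton_congr.mp this
  have : Subsingleton ((R ⧸ I) →ₗ[R] M) :=
    (ModuleCat.homAddEquiv (M := ModuleCat.of R (R ⧸ I)) (N := ModuleCat.of R M)).symm.subsingleton
  let f : (R ⧸ I) →ₗ[R] M := Submodule.liftQ I (LinearMap.toSpanSingleton R M m) (by
    intro r hr; simpa using hm r hr)
  have h0 : f (Submodule.Quotient.mk 1) = 0 := by rw [Subsingleton.elim f 0]; rfl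
  rw [Submodule.liftQ_apply] at h0
  simpa using h0

/-- Local vanishing of `Ext` along `V(I)`. -/
def LocExtVan {A : Type u} [CommRing A] (I : Ideal A) (M : Type u) [AddCommGroup M] [Module A M]
    (n : ℕ) : Prop :=
  ∀ (P : Ideal A) [P.IsPrime], I ≤ P →
    ExtVan (I.map (algebraMap A (Localization.AtPrime P))) (Localization.AtPrime P ⊗[A] M) n

theorem LocExtVan.quot {A : Type u} [CommRing A] {I : Ideal A} {M : Type u} [AddCommGroup M]
    [Module A M] {n : ℕ} (h : LocExtVan I M (n + 1)) {g : A} (hg : IsSMulRegular M g) :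
    LocExtVan I (QuotSMulTop g M) n := by
  intro P _ hP
  have hg' : IsSMulRegular (Localization.AtPrime P ⊗[A] M)
      (algebraMap A (Localization.AtPrime P) g) :=
    hg.of_flat_of_isBaseChange (TensorProduct.isBaseChange A M (Localization.AtPrime P))
  exact ((h P hP).quot hg').congr (QuotSMulTop.algebraMapTensorEquivTensorQuotSMulTop g M _)

theorem LocExtVan.not_le {A : Type u} [CommRing A] [IsNoetherianRing A] {I : Ideal A} {M : Type u}
    [AddCommGroup M] [Module A M] {n : ℕ} (h : LocExtVan I M (n + 1)) (P : Ideal A)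
    (hP : P ∈ associatedPrimes A M) : ¬ I ≤ P := by
  intro hle
  have hprime : P.IsPrime := hP.isPrime
  obtain ⟨m, hm⟩ := (isAssociatedPrime_iff (M := M)).mp hP |>.2
  have hm' : ∀ r, r ∈ P ↔ r • m = 0 := by
    intro r; rw [hm]; simp [Submodule.mem_colon_singleton]
  have hz : (1 : Localization.AtPrime P) ⊗ₜ[A] m = 0 := by
    refine (h P hle).eq_zero _ ?_
    intro r hr
    have : I.map (algebraMap A (Localization.AtPrime P)) ≤
        LinearMap.ker (LinearMap.toSpanSingleton (Localization.AtPrime P) _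
          ((1 : Localization.AtPrime P) ⊗ₜ[A] m)) := by
      rw [Ideal.map_le_iff_le_comap]
      intro a ha
      simp only [Ideal.mem_comap]
      have : algebraMap A (Localization.AtPrime P) a • ((1 : Localization.AtPrime P) ⊗ₜ[A] m) = 0 := by
        rw [algebraMap_smul, ← TensorProduct.tmul_smul, (hm' a).mp (hle ha), TensorProduct.tmul_zero]
      simpa using this
    simpa using this hr
  have hloc : IsLocalizedModule P.primeCompl (TensorProduct.mk A (Localization.AtPrime P) M 1) :=
    (isLocalizedModule_iff_isBaseChange P.primeCompl (Localization.AtPrime P) _).mpr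
      (TensorProduct.isBaseChange A M (Localization.AtPrime P))
  obtain ⟨s, hs⟩ := (IsLocalizedModule.eq_zero_iff P.primeCompl
    (TensorProduct.mk A (Localization.AtPrime P) M 1)).mp hz
  exact s.2 ((hm' s).mpr hs)

theorem exists_reg {A : Type u} [CommRing A] [IsNoetherianRing A] (I : Ideal A) (l : List A)
    (J : Ideal A) (M : Type u) [AddCommGroup M] [Module A M] [Module.Finite A M]
    (h : LocExtVan I M l.length) (hI : I = J ⊔ Ideal.ofList l) :
    ∃ rs : List A, rs.length = l.length ∧ IsWeaklyRegular M rs ∧ I = J ⊔ Ideal.ofList rs := by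
  induction l generalizing J M with
  | nil => exact ⟨[], rfl, by simp, hI⟩
  | cons x l ih =>
    obtain ⟨j, hj, hreg⟩ := coset_avoid (associatedPrimes A M) (associatedPrimes.finite A M)
      (fun p hp => hp.isPrime) x (J ⊔ Ideal.ofList l) (by
        intro p hp hx hle
        apply h.not_le p hp
        rw [hI, Ideal.ofList_cons]
        refine sup_le (le_sup_left.trans hle) (sup_le ?_ (le_sup_right.trans hle))
        simpa [Ideal.span_le] using hx)
    have hg : IsSMulRegular M (x + j) := by
      by_contra hcon
      have : x + j ∈ ⋃ p ∈ associatedPrimes A M, (p : Set A) := by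
        rw [biUnion_associatedPrimes_eq_compl_regular]; exact hcon
      simp only [Set.mem_iUnion] at this
      obtain ⟨p, hp, hmem⟩ := this
      exact hreg p hp hmem
    have key : J ⊔ Ideal.ofList (x :: l) = (J ⊔ Ideal.span {x + j}) ⊔ Ideal.ofList l := by
      have e1 : J ⊔ Ideal.ofList (x :: l) = (J ⊔ Ideal.ofList l) ⊔ Ideal.span {x} := by
        rw [Ideal.ofList_cons]; ac_rfl
      have e2 : (J ⊔ Ideal.span {x + j}) ⊔ Ideal.ofList l =
          (J ⊔ Ideal.ofList l) ⊔ Ideal.span {x + j} := by ac_rfl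
      rw [e1, e2]
      apply le_antisymm
      · refine sup_le le_sup_left ?_
        rw [Ideal.span_singleton_le_iff_mem]
        have := Ideal.sub_mem ((J ⊔ Ideal.ofList l) ⊔ Ideal.span {x + j})
          (Ideal.mem_sup_right (Ideal.mem_span_singleton_self (x + j))) (Ideal.mem_sup_left hj)
        rwa [add_sub_cancel_right] at this
      · refine sup_le le_sup_left ?_
        rw [Ideal.span_singleton_le_iff_mem]
        exact Ideal.add_mem _ (Ideal.mem_sup_right (Ideal.mem_span_singleton_self _))
          (Ideal.mem_sup_left hj)
    obtain ⟨rs, hlen, hrs, hIrs⟩ := ih (J ⊔ Ideal.span {x + j}) (QuotSMulTop (x + j) M)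
      (h.quot hg) (hI.trans key)
    refine ⟨(x + j) :: rs, by simp [hlen], IsWeaklyRegular.cons hg hrs, ?_⟩
    rw [Ideal.ofList_cons, ← sup_assoc]; exact hIrs

/-- A local complete intersection ideal of height `n` in a Noetherian ring is a
complete intersection (generated by a regular sequence of length `n`) if and
only if it can be generated by `n` elements. -/
theorem lci_is_complete_intersection_iff_generated_by_height_many_elements
    {A : Type*} [CommRing A] [IsNoetherianRing A]
    (I : Ideal A) (n : ℕ) (hI : IsLocalCompleteIntersectionOfHeight I n) :
    (∃ rs : List A, rs.length = n ∧ RingTheory.Sequence.IsRegular A rs ∧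
        I = Ideal.ofList rs) ↔
      (∃ f : Fin n → A, I = Ideal.span (Set.range f)) := by
  constructor
  · rintro ⟨rs, rfl, -, rfl⟩
    refine ⟨rs.get, ?_⟩
    rw [Set.range_list_get]; try rfl
  · rintro ⟨f, hf⟩
    have hf' : I = ⊥ ⊔ Ideal.ofList (List.ofFn f) := by
      rw [hf, bot_sup_eq, Ideal.ofList]
      congr 1
      ext; simp [List.mem_ofFn]
    have hvan : LocExtVan I A (List.ofFn f).length := by
      rw [List.length_ofFn]
      intro P _ hP
      obtain ⟨rs, hlen, hreg, hrs⟩ := hI.2 P hP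
      refine ExtVan.congr (M := Localization.AtPrime P) ?_
        (AlgebraTensorModule.rid A (Localization.AtPrime P) (Localization.AtPrime P)).symm
      intro i hi
      refine ModuleCat.subsingleton_ext_of_exists_isRegular
        (I.map (algebraMap A (Localization.AtPrime P))) _ ?_
        (ModuleCat.of _ (Localization.AtPrime P)) ?_ rs ?_ hreg i (hlen ▸ hi)
      · rw [Module.support_eq_zeroLocus, Ideal.annihilator_quotient]
      · rw [← hrs]; exact hreg.top_ne_smul.symm.lt_top
      · intro r hr
        rw [← hrs]; exact Ideal.subset_span hr
    obtain ⟨rs, hlen, hw, hrs⟩ := exists_reg I (List.ofFn f) ⊥ A hvan hf'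
    rw [bot_sup_eq] at hrs
    refine ⟨rs, by simpa using hlen, ⟨hw, ?_⟩, hrs⟩
    rw [← hrs]
    intro htop
    have hIt : I = ⊤ := by simpa using htop.symm
    have h1 := hI.1
    rw [idealHeight, hIt] at h1
    have : (⨅ (p : PrimeSpectrum A) (_ : (⊤ : Ideal A) ≤ p.asIdeal), Order.height p) = ⊤ := by
      simp only [iInf_eq_top]
      intro p hp
      exact absurd (top_le_iff.mp hp) p.isPrime.ne_top
    rw [this] at h1
    exact absurd h1 (ENat.top_ne_natCast n)
end

section
/- Let A be a commutative Noetherian ring and let M be a finitely generated A-module with projective dimension at most 1. Suppose that Ext¹_A(M, A) is a cyclic A-module (generated by one element). Then there exists a short exact sequence 0 → A → P → M → 0 of A-modules, where P is a finitely generated projective A-module. -/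
open CategoryTheory

theorem ses_lemma3 {A : Type u} [CommRing A] {F M : Type u} [AddCommGroup F] [Module A F]
    [AddCommGroup M] [Module A M] [Module.Finite A F] [Module.Projective A F]
    (g : F →ₗ[A] M) (hg : Function.Surjective g)
    [Module.Finite A (LinearMap.ker g)] [Module.Projective A (LinearMap.ker g)]
    (φ : LinearMap.ker g →ₗ[A] A)
    (hφ : ∀ ψ : LinearMap.ker g →ₗ[A] A, ∃ (a : A) (b : F →ₗ[A] A),
      ψ = a • φ + b ∘ₗ (LinearMap.ker g).subtype) :
    ∃ (P : Type u) (_ : AddCommGroup P) (_ : Module A P),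
      Module.Projective A P ∧ Module.Finite A P ∧
      ∃ (f : A →ₗ[A] P) (g : P →ₗ[A] M),
        Function.Injective f ∧ Function.Surjective g ∧ Function.Exact f g := by
  let K := LinearMap.ker g
  let j : K →ₗ[A] A × F := φ.prod K.subtype
  -- retraction
  obtain ⟨n, s, hs⟩ := Module.Finite.exists_fin' A K
  obtain ⟨t, ht⟩ := Module.projective_lifting_property s LinearMap.id hs
  have hext : ∀ i : Fin n, ∃ r : A × F →ₗ[A] A, r ∘ₗ j = LinearMap.proj i ∘ₗ t := by
    intro i
    obtain ⟨a, b, hab⟩ := hφ (LinearMap.proj i ∘ₗ t)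
    refine ⟨LinearMap.coprod (a • LinearMap.id) b, ?_⟩
    rw [hab]
    ext x
    simp [j, K]
  choose r hr using hext
  let ρ : A × F →ₗ[A] K := s ∘ₗ LinearMap.pi r
  have hρ : ρ ∘ₗ j = LinearMap.id := by
    rw [← ht]
    ext x
    have : LinearMap.pi r (j x) = t x := by
      ext i
      exact LinearMap.congr_fun (hr i) x
    simp [ρ, this]
  have hρ' : ∀ x, ρ (j x) = x := LinearMap.congr_fun hρ
  let N := LinearMap.range j
  let π := N.mkQ
  -- section of π
  let σ : ((A × F) ⧸ N) →ₗ[A] A × F := N.liftQ (LinearMap.id - j ∘ₗ ρ) (by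
    rintro _ ⟨x, rfl⟩
    simp [hρ'])
  have hσ : π ∘ₗ σ = LinearMap.id := by
    apply Submodule.linearMap_qext
    refine LinearMap.ext fun x => ?_
    simp only [π, σ, LinearMap.comp_apply, Submodule.mkQ_apply, Submodule.liftQ_apply,
      LinearMap.id_apply, LinearMap.sub_apply]
    rw [Submodule.Quotient.eq]
    refine ⟨- ρ x, ?_⟩
    rw [map_neg]
    abel
  let G : ((A × F) ⧸ N) →ₗ[A] M := N.liftQ (g ∘ₗ LinearMap.snd A A F) (by
    rintro _ ⟨x, rfl⟩
    simp [j, K])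
  refine ⟨(A × F) ⧸ N, inferInstance, inferInstance, Module.Projective.of_split σ π hσ,
    inferInstance, π ∘ₗ LinearMap.inl A A F, G, ?_, ?_, ?_⟩
  · rw [injective_iff_map_eq_zero]
    intro a ha
    simp only [π, LinearMap.comp_apply, Submodule.mkQ_apply, Submodule.Quotient.mk_eq_zero] at ha
    obtain ⟨x, hx⟩ := ha
    simp only [j, LinearMap.prod_apply, Function.prod, LinearMap.inl_apply, Prod.mk.injEq, Submodule.subtype_apply,
      ZeroMemClass.coe_eq_zero] at hx
    rw [← hx.1, hx.2, map_zero]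
  · intro m
    obtain ⟨x, rfl⟩ := hg m
    exact ⟨π (0, x), by simp [G, π]⟩
  · intro y
    obtain ⟨⟨a, x⟩, rfl⟩ := N.mkQ_surjective y
    simp only [G, π, Submodule.mkQ_apply, Submodule.liftQ_apply, LinearMap.comp_apply, LinearMap.snd_apply]
    constructor
    · intro h
      refine ⟨a - φ ⟨x, h⟩, ?_⟩
      simp only [Submodule.mkQ_apply, LinearMap.comp_apply]
      rw [Submodule.Quotient.eq]
      refine ⟨- ⟨x, h⟩, ?_⟩
      simp [j, K]
    · rintro ⟨b, hb⟩
      simp only [Submodule.mkQ_apply, LinearMap.comp_apply] at hb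
      rw [Submodule.Quotient.eq] at hb
      obtain ⟨z, hz⟩ := hb
      have h2 := congrArg Prod.snd hz
      simp [j, K] at h2
      have := z.2
      rw [LinearMap.mem_ker, h2] at this
      simpa using this

theorem ses_lemma2 {A : Type u} [CommRing A] {F M P0 P1 P2 : Type u} [AddCommGroup F] [Module A F]
    [AddCommGroup M] [Module A M] [Module.Projective A F]
    [AddCommGroup P0] [AddCommGroup P1] [AddCommGroup P2]
    [Module A P0] [Module A P1] [Module A P2]
    [Module.Projective A P0]
    (g : F →ₗ[A] M) (hg : Function.Surjective g)
    [Module.Projective A (LinearMap.ker g)]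
    (ε : P0 →ₗ[A] M) (hε : Function.Surjective ε)
    (d1 : P1 →ₗ[A] P0) (d2 : P2 →ₗ[A] P1) (h1 : Function.Exact d1 ε) (h2 : d1 ∘ₗ d2 = 0)
    (c : P1 →ₗ[A] A)
    (hc : ∀ c' : P1 →ₗ[A] A, c' ∘ₗ d2 = 0 → ∃ (a : A) (b : P0 →ₗ[A] A), c' = a • c + b ∘ₗ d1) :
    ∃ φ : LinearMap.ker g →ₗ[A] A, ∀ ψ : LinearMap.ker g →ₗ[A] A, ∃ (a : A) (b : F →ₗ[A] A),
      ψ = a • φ + b ∘ₗ (LinearMap.ker g).subtype := by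
  obtain ⟨u, hu⟩ := Module.projective_lifting_property ε g hε
  obtain ⟨v, hv⟩ := Module.projective_lifting_property g ε hg
  have hu' : ∀ x, ε (u x) = g x := LinearMap.congr_fun hu
  have hv' : ∀ x, g (v x) = ε x := LinearMap.congr_fun hv
  let u1 : LinearMap.ker g →ₗ[A] LinearMap.range d1 :=
    (u ∘ₗ (LinearMap.ker g).subtype).codRestrict _ (fun x => (h1 _).1 (by
      simp [hu']))
  obtain ⟨w, hw⟩ := Module.projective_lifting_property d1.rangeRestrict u1
    d1.surjective_rangeRestrict
  have hw' : ∀ x, d1 (w x) = u x := fun x => congrArg Subtype.val (LinearMap.congr_fun hw x)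
  let v1 : P1 →ₗ[A] LinearMap.ker g := (v ∘ₗ d1).codRestrict _ (fun x => by
    simp [hv', h1.apply_apply_eq_zero])
  let h : F →ₗ[A] LinearMap.ker g := (LinearMap.id - v ∘ₗ u).codRestrict _ (fun x => by
    simp [hv', hu'])
  refine ⟨c ∘ₗ w, fun ψ => ?_⟩
  obtain ⟨a, b, hab⟩ := hc (ψ ∘ₗ v1) (by
    ext x
    have : v1 (d2 x) = 0 := by
      ext
      have := LinearMap.congr_fun h2 x
      simp at this
      simp [v1, this]
    simp [this])
  refine ⟨a, b ∘ₗ u + ψ ∘ₗ h, ?_⟩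
  ext x
  have e1 := LinearMap.congr_fun hab (w x)
  have e2 : x = v1 (w x) + h x := by
    ext
    simp [v1, h, hw']
  simp only [LinearMap.add_apply, LinearMap.smul_apply, LinearMap.comp_apply, hw',
    Submodule.subtype_apply] at e1 ⊢
  conv_lhs => rw [e2]
  rw [map_add, e1, add_assoc]

theorem proj_ker {A : Type u} [CommRing A] {F M : Type u} [AddCommGroup F] [Module A F]
    [AddCommGroup M] [Module A M] [Module.Projective A F] 
    (g : F →ₗ[A] M) (hg : Function.Surjective g)
    (hpd : ∃ (P₀ P₁ : Type u) (_ : AddCommGroup P₀) (_ : AddCommGroup P₁)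
      (_ : Module A P₀) (_ : Module A P₁),
      Module.Projective A P₀ ∧ Module.Projective A P₁ ∧
      ∃ (f : P₁ →ₗ[A] P₀) (g : P₀ →ₗ[A] M),
        Function.Injective f ∧ Function.Surjective g ∧ Function.Exact f g) :
    Module.Projective A (LinearMap.ker g) := by
  obtain ⟨P0, P1, _, _, _, _, _, _, f, ε, hf, hε, hfe⟩ := hpd
  obtain ⟨u, hu⟩ := Module.projective_lifting_property ε g hε
  obtain ⟨v, hv⟩ := Module.projective_lifting_property g ε hg
  have hu' : ∀ x, ε (u x) = g x := LinearMap.congr_fun hu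
  have hv' : ∀ x, g (v x) = ε x := LinearMap.congr_fun hv
  let u1 : LinearMap.ker g →ₗ[A] LinearMap.range f :=
    (u ∘ₗ (LinearMap.ker g).subtype).codRestrict _ (fun x => (hfe _).1 (by
      simp [hu']))
  let w : LinearMap.ker g →ₗ[A] P1 := (LinearEquiv.ofInjective f hf).symm.toLinearMap ∘ₗ u1
  have hw' : ∀ x, f (w x) = u x := fun x =>
    congrArg Subtype.val ((LinearEquiv.ofInjective f hf).apply_symm_apply (u1 x))
  let v1 : P1 →ₗ[A] LinearMap.ker g := (v ∘ₗ f).codRestrict _ (fun x => by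
    simp [hv', hfe.apply_apply_eq_zero])
  let h : F →ₗ[A] LinearMap.ker g := (LinearMap.id - v ∘ₗ u).codRestrict _ (fun x => by
    simp [hv', hu'])
  refine Module.Projective.of_split (w.prod (LinearMap.ker g).subtype) (v1.coprod h) ?_
  ext x
  simp [v1, h, hw']

theorem cocycle_lemma {A : Type u} [CommRing A] (M : ModuleCat.{u} A) (P : ProjectiveResolution M)
    (hcyc : ∃ e : ((Ext A (ModuleCat.{u} A) 1).obj
        (Opposite.op M)).obj (ModuleCat.of A A),
      Submodule.span A {e} = ⊤) :
    ∃ c : P.complex.X 1 →ₗ[A] A,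
      ∀ c' : P.complex.X 1 →ₗ[A] A, c' ∘ₗ (P.complex.d 2 1).hom = 0 →
      ∃ (a : A) (b : P.complex.X 0 →ₗ[A] A), c' = a • c + b ∘ₗ (P.complex.d 1 0).hom := by
  obtain ⟨e, he⟩ := hcyc
  let C := P.complex.linearYonedaObj A (ModuleCat.of A A)
  let S := C.sc' 0 1 2
  let i : ((Ext A (ModuleCat.{u} A) 1).obj
        (Opposite.op M)).obj (ModuleCat.of A A) ≅ S.moduleCatLeftHomologyData.H :=
    P.isoExt 1 _ ≪≫ ShortComplex.homologyMapIso (C.isoSc' 0 1 2 (by simp) (by simp)) ≪≫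
     S.moduleCatHomologyIso
  let i' := i.toLinearEquiv
  obtain ⟨z, hz⟩ := Submodule.mkQ_surjective _ (i' e)
  have key : ∀ y : S.moduleCatLeftHomologyData.H, ∃ a : A, a • i' e = y := by
    intro y
    have : i'.symm y ∈ Submodule.span A {e} := by rw [he]; trivial
    obtain ⟨a, ha⟩ := Submodule.mem_span_singleton.1 this
    exact ⟨a, by rw [← map_smul, ha]; simp⟩
  let z' : P.complex.X 1 ⟶ ModuleCat.of A A := z.1
  refine ⟨z'.hom, fun c' hc' => ?_⟩
  have hm : (ModuleCat.ofHom c' : P.complex.X 1 ⟶ ModuleCat.of A A) ∈ LinearMap.ker S.g.hom := by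
    change P.complex.d 2 1 ≫ ModuleCat.ofHom c' = 0
    ext x
    exact LinearMap.congr_fun hc' x
  obtain ⟨a, ha⟩ := key (Submodule.mkQ _ ⟨ModuleCat.ofHom c', hm⟩)
  rw [← hz] at ha
  have ha2 : Submodule.mkQ (LinearMap.range S.moduleCatToCycles) (a • z) =
      Submodule.mkQ _ ⟨ModuleCat.ofHom c', hm⟩ := (map_smul _ a z).trans ha
  obtain ⟨b, hb⟩ := (Submodule.Quotient.eq _).1 ha2.symm
  let b' : P.complex.X 0 ⟶ ModuleCat.of A A := b
  have hb' : P.complex.d 1 0 ≫ b' = ModuleCat.ofHom c' - a • z' := congrArg Subtype.val hb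
  refine ⟨a, b'.hom, ?_⟩
  have := congrArg ModuleCat.Hom.hom hb'
  simp only [ModuleCat.hom_comp, ModuleCat.hom_sub, ModuleCat.hom_smul, ModuleCat.hom_ofHom] at this
  rw [this]
  abel

/-- Serre's lemma: if `M` is a finitely generated module over a Noetherian ring
with projective dimension at most `1`, and `Ext¹_A(M, A)` is a cyclic
`A`-module, then there is a short exact sequence `0 → A → P → M → 0` with `P`
finitely generated projective. -/
theorem exists_ses_from_ring_to_projective_of_ext_one_cyclic
    {A : Type u} [CommRing A] [IsNoetherianRing A]
    (M : Type u) [AddCommGroup M] [Module A M] [Module.Finite A M]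
    (hpd : ∃ (P₀ P₁ : Type u) (_ : AddCommGroup P₀) (_ : AddCommGroup P₁)
      (_ : Module A P₀) (_ : Module A P₁),
      Module.Projective A P₀ ∧ Module.Projective A P₁ ∧
      ∃ (f : P₁ →ₗ[A] P₀) (g : P₀ →ₗ[A] M),
        Function.Injective f ∧ Function.Surjective g ∧ Function.Exact f g)
    (hcyc : ∃ e : ((Ext A (ModuleCat.{u} A) 1).obj
        (Opposite.op (ModuleCat.of A M))).obj (ModuleCat.of A A),
      Submodule.span A {e} = ⊤) :
    ∃ (P : Type u) (_ : AddCommGroup P) (_ : Module A P),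
      Module.Projective A P ∧ Module.Finite A P ∧
      ∃ (f : A →ₗ[A] P) (g : P →ₗ[A] M),
        Function.Injective f ∧ Function.Surjective g ∧ Function.Exact f g := by
  obtain ⟨n, g, hg⟩ := Module.Finite.exists_fin' A M
  have := proj_ker g hg hpd
  let P := ProjectiveResolution.of (ModuleCat.of A M)
  obtain ⟨c, hc⟩ := cocycle_lemma _ P hcyc
  have : Module.Projective A (P.complex.X 0) :=
    (IsProjective.iff_projective _).2 (P.projective 0)
  let ε : P.complex.X 0 ⟶ ModuleCat.of A M := P.π.f 0
  have hε : Function.Surjective ε.hom :=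
    (ModuleCat.epi_iff_surjective _).1 (inferInstanceAs (Epi (P.π.f 0)))
  have h1 : Function.Exact (P.complex.d 1 0).hom ε.hom :=
    (ShortComplex.ShortExact.moduleCat_exact_iff_function_exact _).1 P.exact₀
  have h2 : (P.complex.d 1 0).hom ∘ₗ (P.complex.d 2 1).hom = 0 :=
    congrArg ModuleCat.Hom.hom (P.complex.d_comp_d 2 1 0)
  obtain ⟨φ, hφ⟩ := ses_lemma2 g hg ε.hom hε _ _ h1 h2 c hc
  exact ses_lemma3 g hg φ hφ
end

section
/- Let A be a commutative Noetherian ring and let I ⊂ A be a local complete intersection ideal of height r. Then there is an isomorphism of A/I-modules Ext^r_A(A/I, A) ≅ Hom_{A/I}(Λ^r(I/I²), A/I), where Λ^r denotes the r-th exterior power over A/I. -/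
open CategoryTheory

section LciHelpers
universe u

section PartB
variable {A : Type u} [CommRing A] {N : ModuleCat.{u} A} (P : ProjectiveResolution N)

noncomputable def lciYMap {M M' : ModuleCat.{u} A} (f : M ⟶ M') :
    P.complex.linearYonedaObj A M ⟶ P.complex.linearYonedaObj A M' where
  f n := ModuleCat.ofHom (Linear.rightComp A (P.complex.X n) f)
  comm' i j _ := by
    apply ModuleCat.hom_ext
    apply LinearMap.ext
    intro x
    exact (Category.assoc (P.complex.d j i) (show P.complex.X i ⟶ M from x) f).symm

lemma lciYMap_apply {M M' : ModuleCat.{u} A} (f : M ⟶ M') (n : ℕ) (x : P.complex.X n ⟶ M) :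
    (lciYMap P f).f n x = x ≫ f := rfl

noncomputable def lciS (M : ModuleCat.{u} A) (x : A) :
    ShortComplex (CochainComplex (ModuleCat.{u} A) ℕ) :=
  ShortComplex.mk (X₁ := P.complex.linearYonedaObj A M) (X₂ := P.complex.linearYonedaObj A M)
    (lciYMap P (x • 𝟙 M)) (lciYMap P (M.smulShortComplex x).g) (by
    apply HomologicalComplex.Hom.ext
    funext n
    apply ModuleCat.hom_ext
    apply LinearMap.ext
    have key : ∀ y : P.complex.X n ⟶ (M.smulShortComplex x).X₁, (y ≫ (M.smulShortComplex x).f) ≫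
        (M.smulShortComplex x).g = 0 := fun y => by
      rw [Category.assoc, ShortComplex.zero, Limits.comp_zero]
    exact fun y => key y)

lemma lciS_shortExact (M : ModuleCat.{u} A) (x : A) (hx : IsSMulRegular M x) :
    (lciS P M x).ShortExact := by
  have hS := hx.smulShortComplex_shortExact
  have := hS.mono_f
  have := hS.epi_g
  apply HomologicalComplex.shortExact_of_degreewise_shortExact
  intro n
  have h1 : Mono (((lciS P M x).map (HomologicalComplex.eval _ _ n)).f) := by
    rw [ModuleCat.mono_iff_injective]
    intro a b h
    exact (cancel_mono (M.smulShortComplex x).f).1 h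
  have h2 : Epi (((lciS P M x).map (HomologicalComplex.eval _ _ n)).g) := by
    rw [ModuleCat.epi_iff_surjective]
    intro a
    have : Epi (M.smulShortComplex x).g := hS.epi_g
    have key : ∀ a : P.complex.X n ⟶ (M.smulShortComplex x).X₃,
      ∃ b : P.complex.X n ⟶ (M.smulShortComplex x).X₂, b ≫ (M.smulShortComplex x).g = a :=
      fun a => ⟨Projective.factorThru a (M.smulShortComplex x).g,
        Projective.factorThru_comp a (M.smulShortComplex x).g⟩
    exact key a
  refine ShortComplex.ShortExact.mk ?_
  rw [ShortComplex.moduleCat_exact_iff]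
  intro a ha
  exact ⟨hS.exact.lift a ha, hS.exact.lift_f a ha⟩

lemma lci_homologyMap_zero (M : ModuleCat.{u} A) (x : A)
    (hx : x ∈ Module.annihilator A N) (n : ℕ) :
    HomologicalComplex.homologyMap (lciYMap P (x • 𝟙 M)) (n + 1) = 0 := by
  have hN : x • 𝟙 N = 0 := by
    ext y
    exact Module.mem_annihilator.1 hx y
  let h : Homotopy (x • 𝟙 P.complex) 0 := ProjectiveResolution.liftHomotopyZero _ (by
    ext
    simp
    rw [← Category.comp_id (P.π.f 0)]
    erw [← Linear.comp_smul, hN, Limits.comp_zero])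
  have hc : ∀ y : P.complex.X (n+1) ⟶ M, P.complex.d (n+2) (n+1) ≫ y = 0 →
      x • y = P.complex.d (n+1) n ≫ h.hom n (n+1) ≫ y := by
    intro y hy
    have := h.comm (n+1)
    simp [dNext_eq _ (show (ComplexShape.down ℕ).Rel (n+1) n by simp),
      prevD_eq _ (show (ComplexShape.down ℕ).Rel (n+2) (n+1) by simp)] at this
    have h2 := congrArg (· ≫ y) this
    simpa [hy] using h2
  rw [← cancel_epi (HomologicalComplex.homologyπ _ _), HomologicalComplex.homologyπ_naturality,
    Limits.comp_zero]
  let k : (P.complex.linearYonedaObj A M).cycles (n+1) ⟶ (P.complex.linearYonedaObj A M).X n :=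
    (P.complex.linearYonedaObj A M).iCycles (n+1) ≫
      ModuleCat.ofHom (Linear.leftComp A M (h.hom n (n+1)))
  have hk : HomologicalComplex.cyclesMap (lciYMap P (x • 𝟙 M)) (n+1) =
      k ≫ (P.complex.linearYonedaObj A M).toCycles n (n+1) := by
    rw [← cancel_mono (HomologicalComplex.iCycles _ _)]
    simp only [HomologicalComplex.cyclesMap_i, Category.assoc, HomologicalComplex.toCycles_i]
    apply ModuleCat.hom_ext
    apply LinearMap.ext
    intro z
    have hz : (P.complex.linearYonedaObj A M).d (n+1) (n+2)
      ((P.complex.linearYonedaObj A M).iCycles (n+1) z) = 0 := by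
      rw [← ModuleCat.comp_apply, HomologicalComplex.iCycles_d]; rfl
    have := hc ((P.complex.linearYonedaObj A M).iCycles (n+1) z) hz
    refine Eq.trans ?_ this
    have key : ∀ y : P.complex.X (n+1) ⟶ M, y ≫ (x • 𝟙 M) = x • y := fun y => by
      rw [Linear.comp_smul, Category.comp_id]
    exact key _
  rw [hk]
  simp


noncomputable def lciPi : P.complex.X 0 ⟶ N := P.π.f 0

instance : Epi (lciPi P) := inferInstanceAs (Epi (P.π.f 0))

lemma lciPi_zero : P.complex.d 1 0 ≫ lciPi P = 0 := P.complex_d_comp_π_f_zero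

lemma lciPi_exact : (ShortComplex.mk _ _ (lciPi_zero P)).Exact := P.exact₀

noncomputable def lciZeroMap (M : ModuleCat.{u} A) :
    (N →ₗ[A] M) →ₗ[A] (P.complex.X 0 ⟶ M) where
  toFun f := lciPi P ≫ ModuleCat.ofHom f
  map_add' _ _ := rfl
  map_smul' _ _ := rfl

lemma lci_homology_zero (M : ModuleCat.{u} A) :
    Nonempty ((P.complex.linearYonedaObj A M).homology 0 ≃ₗ[A] (N →ₗ[A] M)) := by
  let C := P.complex.linearYonedaObj A M
  have e : C.cycles 0 ≅ C.homology 0 := C.isoHomologyπ 0 0 (by simp) (by simp)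
  let φ : ModuleCat.of A (N →ₗ[A] M) ⟶ C.X 0 := ModuleCat.ofHom (lciZeroMap P M)
  have hφ : φ ≫ C.d 0 1 = 0 := by
    apply ModuleCat.hom_ext
    apply LinearMap.ext
    have key : ∀ f : N →ₗ[A] M, P.complex.d 1 0 ≫ (lciPi P ≫ ModuleCat.ofHom f) = 0 := by
      intro f
      rw [← Category.assoc, lciPi_zero, Limits.zero_comp]
    exact fun f => key f
  let ψ := C.liftCycles φ 1 (by simp) hφ
  have hψ : ψ ≫ C.iCycles 0 = φ := by simp [ψ]
  have hinj : Function.Injective φ := by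
    intro f g h
    have := (cancel_epi (lciPi P)).1 (show lciPi P ≫ ModuleCat.ofHom f =
      lciPi P ≫ ModuleCat.ofHom g from h)
    exact congrArg ModuleCat.Hom.hom this
  have hsurj : ∀ y : P.complex.X 0 ⟶ M, P.complex.d 1 0 ≫ y = 0 → ∃ f, φ f = y := by
    intro y hy
    exact ⟨((lciPi_exact P).desc y hy).hom, (lciPi_exact P).g_desc y hy⟩
  have hci : Function.Injective (C.iCycles 0) := (ModuleCat.mono_iff_injective _).1 inferInstance
  have hb : Function.Bijective ψ.hom := by
    constructor
    · intro f g h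
      apply hinj
      rw [← hψ]
      exact congrArg (C.iCycles 0) h
    · intro z
      obtain ⟨f, hf⟩ := hsurj (C.iCycles 0 z) (by
        have : (C.iCycles 0 ≫ C.d 0 1) z = 0 := by rw [HomologicalComplex.iCycles_d]; rfl
        exact this)
      refine ⟨f, hci ?_⟩
      rw [← hf, ← hψ]; rfl
  exact ⟨e.toLinearEquiv.symm.trans (LinearEquiv.ofBijective ψ.hom hb).symm⟩

open RingTheory.Sequence

lemma lci_rees (rs : List A) : ∀ (M : ModuleCat.{u} A),
    (∀ x ∈ rs, x ∈ Module.annihilator A N) → IsWeaklyRegular M rs →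
    (∀ i < rs.length, Limits.IsZero ((P.complex.linearYonedaObj A M).homology i)) ∧
    Nonempty ((P.complex.linearYonedaObj A M).homology rs.length ≃ₗ[A]
      (N →ₗ[A] (M ⧸ (Ideal.ofList rs • ⊤ : Submodule A M)))) := by
  induction rs with
  | nil =>
    intro M _ _
    refine ⟨by simp, ?_⟩
    obtain ⟨e⟩ := lci_homology_zero P M
    refine ⟨e.trans (LinearEquiv.congrRight (Submodule.quotEquivOfEqBot _ (by simp)).symm)⟩
  | cons x rs ih =>
    intro M hrs hreg
    rw [isWeaklyRegular_cons_iff] at hreg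
    obtain ⟨h1, ⟨h2⟩⟩ := ih (ModuleCat.of A (QuotSMulTop x M))
      (fun y hy => hrs y (by simp [hy])) hreg.2
    have hS := lciS_shortExact P M x hreg.1
    have hxN := hrs x (by simp)
    have hzero : ∀ n, HomologicalComplex.homologyMap (lciS P M x).f (n + 1) = 0 := fun n =>
      lci_homologyMap_zero P M x hxN n
    have hepi : ∀ n, Epi (hS.δ n (n+1) (by simp)) := fun n =>
      (hS.homology_exact₁ n (n+1) (by simp)).epi_f (hzero n)
    have hvan : ∀ i < rs.length + 1,
        Limits.IsZero ((P.complex.linearYonedaObj A M).homology i) := by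
      intro i hi
      rcases i with _ | n
      · obtain ⟨e⟩ := lci_homology_zero P M
        have : Subsingleton (N →ₗ[A] M) :=
          IsSMulRegular.linearMap_subsingleton_of_mem_annihilator hreg.1 hxN
        have := e.toEquiv.subsingleton
        exact ModuleCat.isZero_of_subsingleton _
      · exact @Limits.IsZero.of_epi _ _ _ _ _ _ (hepi n) (h1 n (by omega))
    refine ⟨hvan, ?_⟩
    have hmono : Mono (hS.δ rs.length (rs.length + 1) (by simp)) :=
      hS.mono_δ _ _ _ (hvan rs.length (by omega))
    have := hepi rs.length
    have hiso : IsIso (hS.δ rs.length (rs.length + 1) (by simp)) := isIso_of_mono_of_epi _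
    refine ⟨(@asIso _ _ _ _ _ hiso).toLinearEquiv.symm.trans
      (LinearEquiv.trans h2 (LinearEquiv.congrRight
        (Submodule.quotOfListConsSMulTopEquivQuotSMulTopInner M x rs).symm))⟩
end PartB
section PartD
open RingTheory.Sequence

theorem lci_davis {A : Type u} [CommRing A] (a : A) (I' : Ideal A) :
    ∀ (n : ℕ) (T : Finset (Ideal A)), T.card = n → (∀ p ∈ T, p.IsPrime) →
      (∀ p ∈ T, a ∈ p → ¬ I' ≤ p) → ∃ c ∈ I', ∀ p ∈ T, a + c ∉ p := by
  classical
  intro n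
  induction n with
  | zero =>
    intro T hT _ _
    rw [Finset.card_eq_zero] at hT
    subst hT
    exact ⟨0, zero_mem _, by simp⟩
  | succ n ih =>
    intro T hT hp hI
    have hne : T.Nonempty := by
      rw [← Finset.card_pos]; omega
    obtain ⟨p, hpT, hmin⟩ := T.exists_minimal hne
    have hpr := hp p hpT
    obtain ⟨c, hc, hcT⟩ := ih (T.erase p) (by rw [Finset.card_erase_of_mem hpT]; omega)
      (fun q hq => hp q (Finset.mem_of_mem_erase hq)) (fun q hq => hI q (Finset.mem_of_mem_erase hq))
    by_cases h : a + c ∈ p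
    · have hIp : ¬ I' ≤ p := by
        intro hle
        exact hI p hpT ((Ideal.add_mem_iff_left p (hle hc)).1 h) hle
      have hnot : ¬ (I' ⊓ (T.erase p).inf id) ≤ p := by
        intro hle
        rcases hpr.inf_le.1 hle with h1 | h1
        · exact hIp h1
        · obtain ⟨q, hq, hqp⟩ := (Ideal.IsPrime.inf_le' hpr).1 h1
          have := hmin (Finset.mem_of_mem_erase hq) hqp
          exact Finset.ne_of_mem_erase hq (le_antisymm hqp this)
      obtain ⟨d, hd, hdp⟩ := SetLike.not_le_iff_exists.1 hnot
      refine ⟨c + d, add_mem hc hd.1, ?_⟩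
      intro q hq
      rw [← add_assoc]
      by_cases hqp : q = p
      · subst hqp
        intro hh
        exact hdp ((Ideal.add_mem_iff_right q h).1 hh)
      · intro hh
        have hqe : q ∈ T.erase p := Finset.mem_erase.2 ⟨hqp, hq⟩
        have hdq : d ∈ q := (Finset.inf_le (f := id) hqe) hd.2
        exact hcT q hqe ((Ideal.add_mem_iff_left q hdq).1 hh)
    · refine ⟨c, hc, fun q hq => ?_⟩
      by_cases hqp : q = p
      · subst hqp; exact h
      · exact hcT q (Finset.mem_erase.2 ⟨hqp, hq⟩)

/-- append one element -/
theorem lci_append_singleton {A : Type u} [CommRing A] (rs : List A) (a : A) :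
    IsWeaklyRegular A (rs ++ [a]) ↔ IsWeaklyRegular A rs ∧
      ∀ x, a * x ∈ Ideal.ofList rs → x ∈ Ideal.ofList rs := by
  rw [isWeaklyRegular_append_iff, isWeaklyRegular_singleton_iff,
    isSMulRegular_quotient_iff_mem_of_smul_mem]
  simp [smul_eq_mul]

theorem lci_ofList_ofFn {A : Type u} [CommRing A] {n : ℕ} (f : Fin n → A) :
    Ideal.ofList (List.ofFn f) = Ideal.span (Set.range f) := by
  unfold Ideal.ofList
  congr 1
  ext x
  simp [List.mem_ofFn]

theorem lci_perm_local {A : Type u} [CommRing A] [IsNoetherianRing A] [IsLocalRing A] {r : ℕ}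
    (f : Fin r → A) (hf : IsWeaklyRegular A (List.ofFn f))
    (hm : ∀ i, f i ∈ IsLocalRing.maximalIdeal A) (i : Fin r) (a : A)
    (ha : a * f i ∈ Ideal.span (f '' {i}ᶜ)) : a ∈ Ideal.span (f '' {i}ᶜ) := by
  classical
  have hperm : (List.ofFn f).Perm ((((List.finRange r).erase i).map f) ++ [f i]) := by
    rw [List.ofFn_eq_map]
    have h1 : (List.finRange r).Perm (i :: (List.finRange r).erase i) :=
      List.perm_cons_erase (List.mem_finRange i)
    have h2 := (h1.map f)
    rw [List.map_cons] at h2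
    exact h2.trans (List.perm_append_singleton _ _).symm
  have h := IsLocalRing.isWeaklyRegular_of_perm_of_subset_maximalIdeal hf hperm (by
    intro x hx
    obtain ⟨j, rfl⟩ := List.mem_ofFn.1 hx
    exact hm j)
  rw [lci_append_singleton] at h
  have he : Ideal.ofList (((List.finRange r).erase i).map f) = Ideal.span (f '' {i}ᶜ) := by
    unfold Ideal.ofList
    congr 1
    ext x
    simp [List.Nodup.mem_erase_iff (List.nodup_finRange r)]
  rw [he] at h
  exact h.2 a (by rwa [mul_comm])

def LciNorthcott (A : Type u) [CommRing A] (r : ℕ) : Prop :=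
  ∀ (f g : Fin r → A) (M : Matrix (Fin r) (Fin r) A), IsWeaklyRegular A (List.ofFn f) →
    (∀ i, ¬ IsUnit (f i)) → (∀ i, ¬ IsUnit (g i)) → (∀ i, f i = ∑ j, M i j * g j) →
    (∀ w, (∀ i, w * g i ∈ Ideal.span (Set.range f)) →
      ∃ c, w - c * M.det ∈ Ideal.span (Set.range f)) ∧
    (∀ w, w * M.det ∈ Ideal.span (Set.range f) → w ∈ Ideal.span (Set.range g))

theorem lci_span_map_comp {A B : Type*} [CommRing A] [CommRing B] (π : A →+* B) {n : ℕ}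
    (f : Fin n → A) : Ideal.span (Set.range (fun i => π (f i))) =
      (Ideal.span (Set.range f)).map π := by
  rw [Ideal.map_span, ← Set.range_comp]; rfl

theorem lci_northcott_step {A : Type u} [CommRing A] [IsNoetherianRing A] [IsLocalRing A] {r : ℕ}
    (IH : ∀ (B : Type u) [CommRing B] [IsNoetherianRing B] [IsLocalRing B], LciNorthcott B r)
    (f g : Fin (r+1) → A) (M : Matrix (Fin (r+1)) (Fin (r+1)) A)
    (hf : IsWeaklyRegular A (List.ofFn f))
    (hfm : ∀ i, ¬ IsUnit (f i)) (hgm : ∀ i, ¬ IsUnit (g i)) (hM : ∀ i, f i = ∑ j, M i j * g j)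
    (hg0 : ∀ x, g 0 * x ∈ Ideal.span (Set.range fun i : Fin r => f i.castSucc) →
      x ∈ Ideal.span (Set.range fun i : Fin r => f i.castSucc)) :
    (∀ w, (∀ i, w * g i ∈ Ideal.span (Set.range f)) →
      ∃ c, w - c * M.det ∈ Ideal.span (Set.range f)) ∧
    (∀ w, w * M.det ∈ Ideal.span (Set.range f) → w ∈ Ideal.span (Set.range g)) := by
  set f' : Fin r → A := fun i => f i.castSucc with hf'
  set K := Ideal.span (Set.range f') with hK
  set h := g 0 with hh
  set fr := f (Fin.last r) with hfr
  rw [List.ofFn_succ_last, lci_append_singleton, lci_ofList_ofFn] at hf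
  obtain ⟨hfw, hfrreg⟩ := hf
  change IsWeaklyRegular A (List.ofFn f') at hfw
  change ∀ x, fr * x ∈ K → x ∈ K at hfrreg
  have hspanf : Ideal.span (Set.range f) = K ⊔ Ideal.span {fr} := by
    rw [hK, ← Ideal.span_union]
    congr 1
    ext x
    simp only [Set.mem_range, Set.mem_union, Set.mem_singleton_iff]
    constructor
    · rintro ⟨i, rfl⟩
      induction i using Fin.lastCases with
      | last => right; rfl
      | cast i => left; exact ⟨i, rfl⟩
    · rintro (⟨i, rfl⟩ | rfl)
      · exact ⟨i.castSucc, rfl⟩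
      · exact ⟨Fin.last r, rfl⟩
  have hKI : K ≤ Ideal.span (Set.range f) := by rw [hspanf]; exact le_sup_left
  have hfrI : fr ∈ Ideal.span (Set.range f) := Ideal.subset_span ⟨_, rfl⟩
  -- quotient ring
  have hnt : Ideal.span {h} ≠ ⊤ := by
    rw [Ne, Ideal.span_singleton_eq_top]; exact hgm 0
  let B := A ⧸ Ideal.span {h}
  let π : A →+* B := Ideal.Quotient.mk (Ideal.span {h})
  have : Nontrivial B := Ideal.Quotient.nontrivial_iff.2 hnt
  have : IsLocalRing B := IsLocalRing.of_surjective' π Ideal.Quotient.mk_surjective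
  have hunit : ∀ a, ¬ IsUnit a → ¬ IsUnit (π a) := by
    intro a ha hu
    obtain ⟨b, hb⟩ := hu.exists_right_inv
    obtain ⟨b, rfl⟩ := Ideal.Quotient.mk_surjective b
    have h1 : a * b - 1 ∈ Ideal.span {h} := by
      rw [← Ideal.Quotient.eq_zero_iff_mem]
      simpa [sub_eq_zero] using hb
    have h2 : a * b - 1 ∈ IsLocalRing.maximalIdeal A :=
      (Ideal.span_singleton_le_iff_mem _).2 ((IsLocalRing.mem_maximalIdeal _).2 (hgm 0)) h1
    have h3 : a * b ∈ IsLocalRing.maximalIdeal A :=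
      Ideal.mul_mem_right _ _ ((IsLocalRing.mem_maximalIdeal _).2 ha)
    have h4 := sub_mem h3 h2
    rw [sub_sub_cancel] at h4
    exact (Ideal.ne_top_iff_one _).1 (IsLocalRing.maximalIdeal.isMaximal A).ne_top h4
  have hBreg : IsWeaklyRegular B (List.ofFn fun i => π (f' i)) := by
    have h1 : IsWeaklyRegular A (List.ofFn f' ++ [h]) := by
      rw [lci_append_singleton, lci_ofList_ofFn]; exact ⟨hfw, hg0⟩
    have h2 := IsLocalRing.isWeaklyRegular_of_perm_of_subset_maximalIdeal h1
      (List.perm_append_singleton _ _) (by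
        intro x hx
        rw [IsLocalRing.mem_maximalIdeal]
        simp only [List.mem_append, List.mem_ofFn, List.mem_singleton] at hx
        rcases hx with ⟨i, rfl⟩ | rfl
        · exact hfm _
        · exact hgm _)
    rw [isWeaklyRegular_cons_iff] at h2
    have h3 := h2.2
    have e : QuotSMulTop h A ≃ₗ[A] B := Submodule.quotEquivOfEq _ _ (by
      ext x
      simp [Submodule.mem_smul_pointwise_iff_exists, Ideal.mem_span_singleton', mul_comm])
    rw [e.isWeaklyRegular_congr, ← isWeaklyRegular_map_algebraMap_iff B] at h3
    rw [List.map_ofFn] at h3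
    exact h3
  let M₀ : Matrix (Fin r) (Fin r) A := M.submatrix Fin.castSucc Fin.succ
  have hM0 : (M₀.map π).det = π M₀.det := by
    rw [RingHom.map_det]; rfl
  obtain ⟨N1, N2⟩ := IH B (fun i => π (f' i)) (fun j => π (g j.succ)) (M₀.map π) hBreg
    (fun i => hunit _ (hfm _)) (fun i => hunit _ (hgm _)) (by
      intro i
      have := hM i.castSucc
      rw [Fin.sum_univ_succ] at this
      have h0 : π (g 0) = 0 := Ideal.Quotient.eq_zero_iff_mem.2 (Ideal.mem_span_singleton_self _)
      simp only [hf', this, map_add, map_mul, map_sum, h0, mul_zero, zero_add]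
      rfl)
  rw [hM0] at N1 N2
  rw [lci_span_map_comp] at N1 N2
  rw [lci_span_map_comp π (fun j : Fin r => g j.succ)] at N2
  have hmem : ∀ (L : Ideal A) x, π x ∈ L.map π ↔ x ∈ L ⊔ Ideal.span {h} := by
    intro L x
    exact Ideal.mem_quotient_iff_mem_sup
  -- Cramer
  obtain ⟨ε, hε, hcr⟩ : ∃ ε : A, ε * ε = 1 ∧ M.det * h - ε * M₀.det * fr ∈ K := by
    have h1 : M.adjugate.mulVec (M.mulVec g) = M.det • g := by
      rw [Matrix.mulVec_mulVec, Matrix.adjugate_mul, Matrix.smul_mulVec, Matrix.one_mulVec]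
    have h2 : M.mulVec g = f := by
      ext i; rw [hM i]; rfl
    rw [h2] at h1
    have h3 := congrFun h1 0
    simp only [Matrix.mulVec, dotProduct, Pi.smul_apply, smul_eq_mul] at h3
    rw [Fin.sum_univ_castSucc, Matrix.adjugate_fin_succ_eq_det_submatrix M 0 (Fin.last r)] at h3
    refine ⟨(-1) ^ ((Fin.last r : ℕ) + ((0 : Fin (r+1)) : ℕ)), ?_, ?_⟩
    · rw [← pow_add, ← two_mul, pow_mul]; simp
    · have : M.submatrix (Fin.last r).succAbove (Fin.succAbove 0) = M₀ := by
        ext i j; simp [M₀]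
      rw [this] at h3
      rw [← h3]
      rw [add_sub_cancel_right]
      refine Ideal.sum_mem _ fun i _ => Ideal.mul_mem_left _ _ (Ideal.subset_span ⟨i, rfl⟩)
  constructor
  · intro w hw
    have hsp : ∀ i, ∃ v, w * g i - v * fr ∈ K := by
      intro i
      have h0 := hw i
      rw [hspanf] at h0
      obtain ⟨k, hk, b', hb', hkb⟩ := Submodule.mem_sup.1 h0
      obtain ⟨b, rfl⟩ := Ideal.mem_span_singleton'.1 hb'
      exact ⟨b, by rw [← hkb, add_sub_cancel_right]; exact hk⟩
    choose v hv using hsp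
    have h1 : ∀ i, v 0 * g i ∈ K ⊔ Ideal.span {h} := by
      intro i
      have h2 : fr * (v 0 * g i - v i * h) ∈ K := by
        have : fr * (v 0 * g i - v i * h) =
            h * (w * g i - v i * fr) - g i * (w * g 0 - v 0 * fr) := by ring
        rw [this]
        exact sub_mem (K.mul_mem_left _ (hv i)) (K.mul_mem_left _ (hv 0))
      have h3 := hfrreg _ h2
      have : v 0 * g i = (v 0 * g i - v i * h) + v i * h := by ring
      rw [this]
      exact add_mem (Ideal.mem_sup_left h3)
        (Ideal.mem_sup_right (Ideal.mul_mem_left _ _ (Ideal.mem_span_singleton_self _)))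
    obtain ⟨c, hc⟩ := N1 (π (v 0)) (fun i => by rw [← map_mul, hmem]; exact h1 _)
    obtain ⟨c, rfl⟩ := Ideal.Quotient.mk_surjective c
    have hc' : v 0 - c * M₀.det ∈ K ⊔ Ideal.span {h} := by
      rw [← hmem]
      simpa using hc
    obtain ⟨k, hk, b', hb', hkb⟩ := Submodule.mem_sup.1 hc'
    obtain ⟨b, rfl⟩ := Ideal.mem_span_singleton'.1 hb'
    have h4 : h * (w - c * ε * M.det - fr * b) ∈ K := by
      have : h * (w - c * ε * M.det - fr * b) = (w * g 0 - v 0 * fr) + fr * k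
          - c * ε * (M.det * h - ε * M₀.det * fr) := by
        linear_combination -fr * hkb - fr * c * M₀.det * hε
      rw [this]
      exact sub_mem (add_mem (hv 0) (K.mul_mem_left _ hk)) (K.mul_mem_left _ hcr)
    have h5 := hKI (hg0 _ h4)
    refine ⟨c * ε, ?_⟩
    have : w - c * ε * M.det = (w - c * ε * M.det - fr * b) + b * fr := by ring
    rw [this]
    exact add_mem h5 (Ideal.mul_mem_left _ _ hfrI)
  · intro w hw
    rw [hspanf] at hw
    obtain ⟨k, hk, b', hb', hkb⟩ := Submodule.mem_sup.1 hw
    obtain ⟨b, rfl⟩ := Ideal.mem_span_singleton'.1 hb'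
    have h1 : fr * (ε * (w * M₀.det) - b * h) ∈ K := by
      have : fr * (ε * (w * M₀.det) - b * h) = h * k - w * (M.det * h - ε * M₀.det * fr) := by
        linear_combination - h * hkb
      rw [this]
      exact sub_mem (K.mul_mem_left _ hk) (K.mul_mem_left _ hcr)
    have h2 := hfrreg _ h1
    have h3 : w * M₀.det ∈ K ⊔ Ideal.span {h} := by
      have : w * M₀.det = ε * (ε * (w * M₀.det) - b * h) + (ε * b) * h := by
        linear_combination - w * M₀.det * hε
      rw [this]
      exact add_mem (Ideal.mem_sup_left (K.mul_mem_left _ h2))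
        (Ideal.mem_sup_right (Ideal.mul_mem_left _ _ (Ideal.mem_span_singleton_self _)))
    have h4 := N2 (π w) (by rw [← map_mul, hmem]; exact h3)
    rw [hmem] at h4
    refine (show _ ≤ Ideal.span (Set.range g) from sup_le ?_ ?_) h4
    · refine Ideal.span_mono ?_
      rintro _ ⟨j, rfl⟩
      exact ⟨_, rfl⟩
    · rw [Ideal.span_singleton_le_iff_mem]
      exact Ideal.subset_span ⟨0, rfl⟩


theorem lci_northcott_local (r : ℕ) : ∀ (A : Type u) [CommRing A] [IsNoetherianRing A]
    [IsLocalRing A], LciNorthcott A r := by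
  induction r with
  | zero =>
    intro A _ _ _ f g M hf _ _ _
    constructor
    · intro w _
      exact ⟨w, by simp⟩
    · intro w hw
      have h1 : Set.range f = Set.range g := by
        rw [Set.range_eq_empty, Set.range_eq_empty]
      rw [← h1]
      simpa using hw
  | succ r IH =>
    intro A _ _ _ f g M hf hfm hgm hM
    let K := Ideal.span (Set.range fun i : Fin r => f i.castSucc)
    let I' := Ideal.span (Set.range fun j : Fin r => g j.succ)
    let fr := f (Fin.last r)
    have hf2 := hf
    rw [List.ofFn_succ_last, lci_append_singleton, lci_ofList_ofFn] at hf2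
    have hfin := associatedPrimes.finite A (A ⧸ K)
    have hun := biUnion_associatedPrimes_eq_compl_regular A (A ⧸ K)
    have hreg : ∀ a : A, (∀ p ∈ associatedPrimes A (A ⧸ K), a ∉ p) ↔
        ∀ x, a * x ∈ K → x ∈ K := by
      intro a
      rw [← show IsSMulRegular (A ⧸ K) a ↔ ∀ x, a * x ∈ K → x ∈ K from
        isSMulRegular_quotient_iff_mem_of_smul_mem K a]
      have := Set.ext_iff.1 hun a
      simp only [Set.mem_iUnion, Set.mem_compl_iff] at this
      rw [← not_iff_not, not_forall]
      simpa using this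
    have hfr := (hreg fr).2 hf2.2
    obtain ⟨d, hd, hdT⟩ := lci_davis (g 0) I' _ hfin.toFinset rfl
      (fun p hp => (hfin.mem_toFinset.1 hp).isPrime) (by
        intro p hp h0 hle
        refine hfr p (hfin.mem_toFinset.1 hp) ?_
        simp only [fr]
        rw [hM, Fin.sum_univ_succ]
        refine add_mem (p.mul_mem_left _ h0) (p.sum_mem fun j _ => p.mul_mem_left _ (hle ?_))
        exact Ideal.subset_span ⟨j, rfl⟩)
    obtain ⟨c, hc⟩ := Ideal.mem_span_range_iff_exists_fun.1 hd
    let g' : Fin (r+1) → A := Fin.cons (g 0 + d) (fun j => g j.succ)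
    let M' : Matrix (Fin (r+1)) (Fin (r+1)) A :=
      fun i => Fin.cons (M i 0) (fun j => M i j.succ - c j * M i 0)
    have hdet : M'.det = M.det := by
      rw [← Matrix.det_transpose M', ← Matrix.det_transpose M]
      refine Matrix.det_eq_of_forall_row_eq_smul_add_const (Fin.cons 0 (fun j => - c j)) 0 rfl ?_
      intro j i
      refine Fin.cases ?_ (fun j => ?_) j
      · simp [M']; rfl
      · simp [M', sub_eq_add_neg]; rfl
    have hdm : d ∈ IsLocalRing.maximalIdeal A := by
      refine (show I' ≤ _ from Ideal.span_le.2 ?_) hd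
      rintro _ ⟨j, rfl⟩
      exact (IsLocalRing.mem_maximalIdeal _).2 (hgm _)
    have key := lci_northcott_step IH f g' M' hf hfm (by
      intro i
      refine Fin.cases ?_ (fun j => ?_) i
      · have : g 0 + d ∈ IsLocalRing.maximalIdeal A :=
          add_mem ((IsLocalRing.mem_maximalIdeal _).2 (hgm 0)) hdm
        exact (IsLocalRing.mem_maximalIdeal _).1 this
      · exact hgm _) (by
      intro i
      rw [hM, Fin.sum_univ_succ, Fin.sum_univ_succ]
      simp only [M', g', Fin.cons_zero, Fin.cons_succ, ← hc, sub_mul, Finset.sum_sub_distrib,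
        mul_add, Finset.mul_sum]
      have : ∀ j : Fin r, c j * M i 0 * g j.succ = M i 0 * (c j * g j.succ) := fun j => by ring
      simp only [this]
      ring) ((hreg _).1 (fun p hp => hdT p (hfin.mem_toFinset.2 hp)))
    rw [hdet] at key
    have hI'le : I' ≤ Ideal.span (Set.range g) := by
      refine Ideal.span_mono ?_
      rintro _ ⟨j, rfl⟩
      exact ⟨_, rfl⟩
    refine ⟨fun w hw => key.1 w ?_, fun w hw => ?_⟩
    · intro i
      refine Fin.cases ?_ (fun j => hw _) i
      change w * (g 0 + d) ∈ _
      rw [mul_add, ← hc, Finset.mul_sum]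
      refine add_mem (hw 0) (Ideal.sum_mem _ fun j _ => ?_)
      rw [mul_left_comm]
      exact Ideal.mul_mem_left _ _ (hw _)
    · refine (Ideal.span_le.2 ?_ : _ ≤ Ideal.span (Set.range g)) (key.2 w hw)
      rintro _ ⟨i, rfl⟩
      refine Fin.cases ?_ (fun j => ?_) i
      · exact add_mem (Ideal.subset_span ⟨_, rfl⟩) (hI'le hd)
      · exact Ideal.subset_span ⟨_, rfl⟩

end PartD
section PartE
open RingTheory.Sequence

theorem lci_local_mem {A : Type u} [CommRing A] (I : Ideal A) {X : Type*} [AddCommGroup X]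
    [Module A X] (N : Submodule A X) (h : X) (hI : ∀ y ∈ I, y • h ∈ N)
    (hloc : ∀ P : Ideal A, P.IsPrime → I ≤ P → ∃ s, s ∉ P ∧ s • h ∈ N) : h ∈ N := by
  by_contra hh
  let L : Ideal A := N.comap (LinearMap.toSpanSingleton A X h)
  have hL : ∀ a, a ∈ L ↔ a • h ∈ N := by intro a; simp [L]
  have hne : L ≠ ⊤ := by
    intro htop
    apply hh
    have : (1 : A) ∈ L := by rw [htop]; trivial
    rw [hL] at this
    simpa using this
  obtain ⟨P, hP, hLP⟩ := L.exists_le_maximal hne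
  obtain ⟨s, hs, hs'⟩ := hloc P hP.isPrime (fun y hy => hLP ((hL y).2 (hI y hy)))
  exact hs (hLP ((hL s).2 hs'))

theorem lci_loc_mem_iff {A : Type u} [CommRing A] (P : Ideal A) [P.IsPrime] (J : Ideal A) (a : A) :
    algebraMap A (Localization.AtPrime P) a ∈ J.map (algebraMap A (Localization.AtPrime P)) ↔
      ∃ s, s ∉ P ∧ s * a ∈ J := by
  rw [IsLocalization.algebraMap_mem_map_algebraMap_iff P.primeCompl]
  rfl

theorem lci_depth {A : Type u} [CommRing A] (I : Ideal A) (g f : List A)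
    (hg : IsWeaklyRegular A g) (hf : IsWeaklyRegular A f) (hgI : ∀ x ∈ g, x ∈ I)
    (hfI : ∀ x ∈ f, x ∈ I) (hlen : f.length < g.length) (a : A)
    (ha : ∀ y ∈ I, a * y ∈ Ideal.ofList f) : a ∈ Ideal.ofList f := by
  let P := ProjectiveResolution.of (ModuleCat.of A (A ⧸ I))
  have hann : Module.annihilator A (A ⧸ I) = I := Ideal.annihilator_quotient
  have h1 := (lci_rees P g (ModuleCat.of A A) (fun x hx => by
    change x ∈ Module.annihilator A (A ⧸ I)
    rw [hann]; exact hgI x hx) hg).1 f.length hlen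
  obtain ⟨e⟩ := (lci_rees P f (ModuleCat.of A A) (fun x hx => by
    change x ∈ Module.annihilator A (A ⧸ I)
    rw [hann]; exact hfI x hx) hf).2
  have h2 : Subsingleton ((P.complex.linearYonedaObj A (ModuleCat.of A A)).homology f.length) :=
    ModuleCat.subsingleton_of_isZero h1
  have h3 := e.symm.toEquiv.subsingleton
  let J : Submodule A A := Ideal.ofList f • ⊤
  have hJ : J = Ideal.ofList f := by simp [J]
  have h4 : Subsingleton ((A ⧸ I) →ₗ[A] (A ⧸ J)) := h3
  let φ : (A ⧸ I) →ₗ[A] (A ⧸ J) := Submodule.liftQ I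
    (LinearMap.toSpanSingleton A _ (Submodule.Quotient.mk a)) (by
      intro y hy
      rw [LinearMap.mem_ker, LinearMap.toSpanSingleton_apply, ← Submodule.Quotient.mk_smul,
        Submodule.Quotient.mk_eq_zero, hJ, smul_eq_mul, mul_comm]
      exact ha y hy)
  have h5 : φ (Submodule.Quotient.mk 1) = 0 := by
    rw [Subsingleton.elim φ 0]; rfl
  have h6 : φ (Submodule.Quotient.mk 1) = Submodule.Quotient.mk a := by
    exact (Submodule.liftQ_apply _ _ _).trans (one_smul A _)
  rw [h6, Submodule.Quotient.mk_eq_zero, hJ] at h5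
  exact h5

/-- local form of the complete intersection hypothesis -/
def LciLoc {A : Type u} [CommRing A] (I : Ideal A) (n : ℕ) : Prop :=
  ∀ (P : Ideal A) [P.IsPrime], I ≤ P →
    ∃ rs : List (Localization.AtPrime P),
      rs.length = n ∧ RingTheory.Sequence.IsRegular (Localization.AtPrime P) rs ∧
      Ideal.ofList rs = I.map (algebraMap A (Localization.AtPrime P))

theorem lci_exists_list {A : Type u} [CommRing A] [IsNoetherianRing A] (I : Ideal A) (r : ℕ)
    (hI : LciLoc I r) : ∀ k ≤ r, ∃ f : List A, f.length = k ∧ IsWeaklyRegular A f ∧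
      ∀ x ∈ f, x ∈ I := by
  intro k
  induction k with
  | zero => exact fun _ => ⟨[], rfl, by simp, by simp⟩
  | succ k ih =>
    intro hk
    obtain ⟨f, hfl, hfw, hfI⟩ := ih (by omega)
    have key : ∀ a : A, (∀ y ∈ I, a * y ∈ Ideal.ofList f) → a ∈ Ideal.ofList f := by
      intro a ha
      refine lci_local_mem I (Ideal.ofList f) a (fun y hy => by
        rw [smul_eq_mul, mul_comm]; exact ha y hy) ?_
      intro P hP hIP
      obtain ⟨rs, hrl, hrr, hrI⟩ := hI P hIP
      have := lci_depth (I.map (algebraMap A (Localization.AtPrime P))) rs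
        (f.map (algebraMap A (Localization.AtPrime P))) hrr.toIsWeaklyRegular
        (hfw.of_flat) (fun x hx => by
          rw [← hrI]; exact Ideal.subset_span hx) (fun x hx => by
          obtain ⟨y, hy, rfl⟩ := List.mem_map.1 hx
          exact Ideal.mem_map_of_mem _ (hfI y hy)) (by simp; omega)
        (algebraMap _ _ a) (by
          intro y hy
          rw [← Ideal.map_ofList]
          refine Submodule.span_induction (p := fun y _ => algebraMap A (Localization.AtPrime P) a * y ∈ _) ?_ ?_ ?_ ?_ hy
          · rintro _ ⟨y, hy, rfl⟩
            rw [← map_mul]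
            exact Ideal.mem_map_of_mem _ (ha y hy)
          · simp
          · intro x y _ _ hx hy
            rw [mul_add]; exact add_mem hx hy
          · intro c x _ hx
            rw [smul_eq_mul, mul_left_comm]
            exact Ideal.mul_mem_left _ _ hx)
      rw [← Ideal.map_ofList, lci_loc_mem_iff] at this
      exact this
    have hss : Subsingleton ((A ⧸ I) →ₗ[A] (A ⧸ Ideal.ofList f)) := by
      refine ⟨fun φ ψ => ?_⟩
      have : ∀ φ : (A ⧸ I) →ₗ[A] (A ⧸ Ideal.ofList f), φ = 0 := by
        intro φ
        obtain ⟨a, ha⟩ := Ideal.Quotient.mk_surjective (φ (Ideal.Quotient.mk I 1))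
        have h0 : a ∈ Ideal.ofList f := key a (fun y hy => by
          rw [← Ideal.Quotient.eq_zero_iff_mem, mul_comm, ← smul_eq_mul]
          change y • Ideal.Quotient.mk _ a = 0
          rw [ha, ← map_smul]
          have : y • Ideal.Quotient.mk I 1 = 0 := by
            change Ideal.Quotient.mk I (y • 1) = 0
            rw [Ideal.Quotient.eq_zero_iff_mem]
            simpa using hy
          rw [this, map_zero])
        rw [Ideal.Quotient.eq_zero_iff_mem.2 h0] at ha
        ext
        exact ha.symm
      rw [this φ, this ψ]
    obtain ⟨a, ha, har⟩ := IsSMulRegular.subsingleton_linearMap_iff.1 hss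
    rw [Ideal.annihilator_quotient] at ha
    rw [isSMulRegular_quotient_iff_mem_of_smul_mem] at har
    refine ⟨f ++ [a], by simp [hfl], (lci_append_singleton f a).2 ⟨hfw, har⟩, ?_⟩
    intro x hx
    rcases List.mem_append.1 hx with h | h
    · exact hfI x h
    · rw [List.mem_singleton.1 h]; exact ha

theorem lci_ext_iso {A : Type u} [CommRing A] (I : Ideal A) {r : ℕ} (f : Fin r → A)
    (hf : IsWeaklyRegular A (List.ofFn f)) (hfI : ∀ i, f i ∈ I) :
    Nonempty ((((Ext A (ModuleCat.{u} A) r).obj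
        (Opposite.op (ModuleCat.of A (A ⧸ I)))).obj (ModuleCat.of A A)) ≃ₗ[A]
      ((A ⧸ I) →ₗ[A] (A ⧸ Ideal.span (Set.range f)))) := by
  let P := ProjectiveResolution.of (ModuleCat.of A (A ⧸ I))
  obtain ⟨e⟩ := (lci_rees P (List.ofFn f) (ModuleCat.of A A) (fun x hx => by
    change x ∈ Module.annihilator A (A ⧸ I)
    obtain ⟨i, rfl⟩ := List.mem_ofFn.1 hx
    rw [Ideal.annihilator_quotient]; exact hfI i) hf).2
  have e1 := (P.isoExt (R := A) r (ModuleCat.of A A)).toLinearEquiv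
  rw [List.length_ofFn] at e
  have e2 : (A ⧸ (Ideal.ofList (List.ofFn f) • ⊤ : Submodule A A)) ≃ₗ[A]
      (A ⧸ Ideal.span (Set.range f)) := Submodule.quotEquivOfEq _ _ (by
        rw [lci_ofList_ofFn]; simp)
  have e3 : ((A ⧸ I) →ₗ[A] (A ⧸ (Ideal.ofList (List.ofFn f) • ⊤ : Submodule A A))) ≃ₗ[A]
    ((A ⧸ I) →ₗ[A] (A ⧸ Ideal.span (Set.range f))) := LinearEquiv.congrRight e2
  exact ⟨(e1.trans e).trans e3⟩

end PartE

section PartF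
open RingTheory.Sequence

theorem lci_perm_global {A : Type u} [CommRing A] [IsNoetherianRing A] {r : ℕ}
    (f : Fin r → A) (hf : IsWeaklyRegular A (List.ofFn f)) (i : Fin r) (a : A)
    (ha : a * f i ∈ Ideal.span (f '' {i}ᶜ)) : a ∈ Ideal.span (Set.range f) := by
  refine lci_local_mem ⊥ _ a (fun y hy => by
    rw [Ideal.mem_bot.1 hy, zero_smul]; exact zero_mem _) ?_
  intro P hP _
  by_cases hk : ∃ k, f k ∉ P
  · obtain ⟨k, hk⟩ := hk
    exact ⟨f k, hk, Ideal.mul_mem_right _ _ (Ideal.subset_span ⟨k, rfl⟩)⟩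
  · push Not at hk
    let φ := algebraMap A (Localization.AtPrime P)
    have hm : Ideal.span ((fun i => φ (f i)) '' {i}ᶜ) = (Ideal.span (f '' {i}ᶜ)).map φ := by
      rw [Ideal.map_span, Set.image_image]
    have h1 := lci_perm_local (fun i => φ (f i)) (by
      have := hf.of_flat (S := Localization.AtPrime P)
      rw [List.map_ofFn] at this
      exact this) (fun j => by
        rw [← Localization.AtPrime.map_eq_maximalIdeal]
        exact Ideal.mem_map_of_mem _ (hk j)) i (φ a) (by
        rw [hm, ← map_mul]
        exact Ideal.mem_map_of_mem _ ha)
    rw [hm, lci_loc_mem_iff] at h1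
    obtain ⟨s, hs, hsa⟩ := h1
    exact ⟨s, hs, Ideal.span_mono (Set.image_subset_range _ _) hsa⟩

theorem lci_cramer {A : Type u} [CommRing A] {r : ℕ} (W : Matrix (Fin r) (Fin r) A)
    (x F : Fin r → A) (h : ∀ i, F i = ∑ j, W i j * x j) (L : Ideal A) (hF : ∀ i, F i ∈ L)
    (j : Fin r) : W.det * x j ∈ L := by
  have h1 : W.adjugate.mulVec (W.mulVec x) = W.det • x := by
    rw [Matrix.mulVec_mulVec, Matrix.adjugate_mul, Matrix.smul_mulVec, Matrix.one_mulVec]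
  have h2 : W.mulVec x = F := by
    ext i; rw [h i]; rfl
  rw [h2] at h1
  have h3 := congrFun h1 j
  simp only [Matrix.mulVec, dotProduct, Pi.smul_apply, smul_eq_mul] at h3
  rw [← h3]
  exact L.sum_mem fun i _ => L.mul_mem_left _ (hF i)

theorem lci_mul_span {A : Type u} [CommRing A] {r : ℕ} (x : Fin r → A) (L : Ideal A) (a y : A)
    (h : ∀ j, a * x j ∈ L) (hy : y ∈ Ideal.span (Set.range x)) : a * y ∈ L := by
  obtain ⟨c, rfl⟩ := Ideal.mem_span_range_iff_exists_fun.1 hy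
  rw [Finset.mul_sum]
  refine L.sum_mem fun i _ => ?_
  rw [mul_left_comm]
  exact L.mul_mem_left _ (h i)

theorem lci_indep {A : Type u} [CommRing A] [IsNoetherianRing A] {r : ℕ}
    (f : Fin r → A) (hf : IsWeaklyRegular A (List.ofFn f)) (W W' : Matrix (Fin r) (Fin r) A)
    (x : Fin r → A) (c s : A) (hW : ∀ i, c * f i = ∑ j, W i j * x j)
    (hW' : ∀ i, c * f i = ∑ j, W' i j * x j)
    (hs : ∀ i, s * f i ∈ Ideal.span (Set.range x)) :
    s * (W'.det - W.det) ∈ Ideal.span (Set.range f) := by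
  classical
  let hyb : Finset (Fin r) → Matrix (Fin r) (Fin r) A := fun S i => if i ∈ S then W' i else W i
  have hyb_x : ∀ S i, c * f i = ∑ j, hyb S i j * x j := by
    intro S i
    by_cases h : i ∈ S
    · simp only [hyb, h, if_true]; exact hW' i
    · simp only [hyb, h, if_false]; exact hW i
  have key : ∀ S, s * ((hyb S).det - W.det) ∈ Ideal.span (Set.range f) := by
    intro S
    induction S using Finset.induction_on with
    | empty => simp [hyb]
    | insert i S hi ih =>
      let V := (hyb S).updateRow i (W' i - W i)
      have e1 : hyb (insert i S) = (hyb S).updateRow i (W' i) := by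
        ext k l
        by_cases hk : k = i
        · subst hk
          rw [Matrix.updateRow_self]; simp [hyb]
        · rw [Matrix.updateRow_ne hk]; simp [hyb, hk]
      have e2 : hyb S = (hyb S).updateRow i (W i) := by
        ext k l
        by_cases hk : k = i
        · subst hk
          rw [Matrix.updateRow_self]; simp [hyb, hi]
        · simp [hk]
      have e3 : (hyb (insert i S)).det = (hyb S).det + V.det := by
        rw [e1]
        have : W' i = W i + (W' i - W i) := by abel
        conv_lhs => rw [this]
        rw [Matrix.det_updateRow_add, ← e2]
      have hV : ∀ k, (Function.update (fun k => c * f k) i 0) k = ∑ j, V k j * x j := by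
        intro k
        by_cases hk : k = i
        · subst hk
          simp only [Function.update_self, V, Matrix.updateRow_self, Pi.sub_apply, sub_mul,
            Finset.sum_sub_distrib, ← hW, ← hW', sub_self]
        · simp only [Function.update_of_ne hk, V, Matrix.updateRow_ne hk]
          exact hyb_x S k
      have h1 := lci_cramer V x _ hV (Ideal.span (f '' {i}ᶜ)) (by
        intro k
        by_cases hk : k = i
        · subst hk; simp
        · rw [Function.update_of_ne hk]
          exact Ideal.mul_mem_left _ _ (Ideal.subset_span ⟨k, hk, rfl⟩))
      have h2 := lci_mul_span x _ V.det _ h1 (hs i)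
      have h3 := lci_perm_global f hf i (s * V.det) (by
        have : s * V.det * f i = V.det * (s * f i) := by ring
        rw [this]; exact h2)
      rw [e3]
      have : s * ((hyb S).det + V.det - W.det) = s * ((hyb S).det - W.det) + s * V.det := by ring
      rw [this]
      exact add_mem ih h3
  have := key Finset.univ
  simpa [hyb] using this

theorem lci_uniform {A : Type u} [CommRing A] (P : Ideal A) [P.IsPrime] {X : Type*} [AddCommGroup X]
    [Module A X] (N : Submodule A X) (L : Submodule A X) (hL : L.FG)
    (h : ∀ y ∈ L, ∃ s, s ∉ P ∧ s • y ∈ N) : ∃ s, s ∉ P ∧ ∀ y ∈ L, s • y ∈ N := by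
  induction L, hL using Submodule.fg_induction with
  | singleton x =>
    obtain ⟨s, hs, hsx⟩ := h x (Submodule.mem_span_singleton_self x)
    refine ⟨s, hs, fun y hy => ?_⟩
    obtain ⟨a, rfl⟩ := Submodule.mem_span_singleton.1 hy
    rw [smul_comm]
    exact N.smul_mem _ hsx
  | sup L₁ L₂ _ _ h1 h2 =>
    obtain ⟨s, hs, hs1⟩ := h1 (fun y hy => h y (Submodule.mem_sup_left hy))
    obtain ⟨t, ht, ht1⟩ := h2 (fun y hy => h y (Submodule.mem_sup_right hy))
    refine ⟨s * t, fun hst => (Ideal.IsPrime.mem_or_mem ‹_› hst).elim hs ht, fun y hy => ?_⟩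
    obtain ⟨a, ha, b, hb, rfl⟩ := Submodule.mem_sup.1 hy
    rw [smul_add]
    refine add_mem ?_ ?_
    · rw [mul_comm, mul_smul]; exact N.smul_mem _ (hs1 a ha)
    · rw [mul_smul]; exact N.smul_mem _ (ht1 b hb)

theorem lci_chart {A : Type u} [CommRing A] [IsNoetherianRing A] (I : Ideal A) (r : ℕ)
    (hI : LciLoc I r) (P : Ideal A) [P.IsPrime] (hIP : I ≤ P) :
    ∃ (x : Fin r → A) (s : A), s ∉ P ∧ (∀ i, x i ∈ I) ∧
      (∀ y ∈ I, s * y ∈ Ideal.span (Set.range x)) ∧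
      ∀ (a : Fin r → A), ∑ j, a j * x j = 0 → ∀ i, ∃ t, t ∉ P ∧ t * a i ∈ I := by
  let φ := algebraMap A (Localization.AtPrime P)
  obtain ⟨rs, hrl, hrr, hrI⟩ := hI P hIP
  subst hrl
  let g : Fin rs.length → Localization.AtPrime P := rs.get
  have hg : List.ofFn g = rs := List.ofFn_get rs
  have hspg : Ideal.span (Set.range g) = I.map φ := by
    rw [← lci_ofList_ofFn, hg, hrI]
  have hgI : ∀ i, g i ∈ I.map φ := fun i => by
    rw [← hspg]; exact Ideal.subset_span ⟨i, rfl⟩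
  have hgm : ∀ i, g i ∈ IsLocalRing.maximalIdeal (Localization.AtPrime P) := fun i => by
    rw [← Localization.AtPrime.map_eq_maximalIdeal]
    exact Ideal.map_mono hIP (hgI i)
  have hx : ∀ i, ∃ (x s : A), x ∈ I ∧ s ∉ P ∧ g i * φ s = φ x := by
    intro i
    obtain ⟨⟨x, s⟩, h⟩ := (IsLocalization.mem_map_algebraMap_iff P.primeCompl _).1 (hgI i)
    exact ⟨x, s, x.2, s.2, h⟩
  choose x σ hxI hσ hgx using hx
  have hu : ∀ s, s ∉ P → IsUnit (φ s) := fun s hs =>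
    IsLocalization.map_units (Localization.AtPrime P) (⟨s, hs⟩ : P.primeCompl)
  have hspx : I.map φ ≤ (Ideal.span (Set.range x)).map φ := by
    rw [← hspg, Ideal.span_le]
    rintro _ ⟨i, rfl⟩
    obtain ⟨b, hb⟩ := (hu _ (hσ i)).exists_right_inv
    have : g i = b * φ (x i) := by
      rw [← hgx, mul_left_comm, mul_comm b, hb, mul_one]
    rw [this]
    exact Ideal.mul_mem_left _ _ (Ideal.mem_map_of_mem _ (Ideal.subset_span ⟨i, rfl⟩))
  obtain ⟨s, hs, hsI⟩ := lci_uniform P (Ideal.span (Set.range x)) I (IsNoetherian.noetherian I) (by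
    intro y hy
    exact (lci_loc_mem_iff P _ y).1 (hspx (Ideal.mem_map_of_mem _ hy)))
  refine ⟨x, s, hs, hxI, hsI, ?_⟩
  intro a ha i
  have h1 := lci_perm_local g (by rw [hg]; exact hrr.toIsWeaklyRegular) hgm i (φ (a i * σ i)) (by
    have h2 : φ (a i * σ i) * g i = - ∑ j ∈ Finset.univ.erase i, φ (a j * σ j) * g j := by
      rw [eq_neg_iff_add_eq_zero, Finset.add_sum_erase _ (fun j => φ (a j * σ j) * g j)
        (Finset.mem_univ i), ← map_zero φ, ← ha, map_sum]
      refine Finset.sum_congr rfl fun j _ => ?_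
      rw [map_mul, map_mul, ← hgx]
      ring
    rw [h2]
    refine neg_mem (Ideal.sum_mem _ fun j hj => Ideal.mul_mem_left _ _ (Ideal.subset_span ⟨j, ?_, rfl⟩))
    exact Finset.ne_of_mem_erase hj)
  have h3 : φ (a i * σ i) ∈ I.map φ := by
    rw [← hspg]
    exact Ideal.span_mono (Set.image_subset_range _ _) h1
  obtain ⟨t, ht, hta⟩ := (lci_loc_mem_iff P _ _).1 h3
  refine ⟨t * σ i, fun h => (Ideal.IsPrime.mem_or_mem ‹_› h).elim ht (hσ i), ?_⟩
  have : t * σ i * a i = t * (a i * σ i) := by ring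
  rw [this]; exact hta

theorem lci_northcott {A : Type u} [CommRing A] [IsNoetherianRing A] (I : Ideal A) {r : ℕ}
    (f : Fin r → A) (hf : IsWeaklyRegular A (List.ofFn f)) (hfI : ∀ i, f i ∈ I)
    (P : Ideal A) [P.IsPrime] (hIP : I ≤ P) (x : Fin r → A) (hx : ∀ i, x i ∈ I) (s : A) (hs : s ∉ P)
    (M : Matrix (Fin r) (Fin r) A) (hM : ∀ i, s * f i = ∑ j, M i j * x j) :
    (∀ w, (∀ y ∈ I, w * y ∈ Ideal.span (Set.range f)) → ∃ t c, t ∉ P ∧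
      t * w - c * M.det ∈ Ideal.span (Set.range f)) ∧
    (∀ w, w * M.det ∈ Ideal.span (Set.range f) → ∃ t, t ∉ P ∧ t * w ∈ I) := by
  let φ := algebraMap A (Localization.AtPrime P)
  have hu : IsUnit (φ s) :=
    IsLocalization.map_units (Localization.AtPrime P) (⟨s, hs⟩ : P.primeCompl)
  obtain ⟨σ, hσ⟩ := hu.exists_right_inv
  have hdet : (σ • M.map φ).det = σ ^ r * φ M.det := by
    rw [Matrix.det_smul, Fintype.card_fin, RingHom.map_det]; rfl
  have hm : ∀ y ∈ I, ¬ IsUnit (φ y) := by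
    intro y hy
    rw [← mem_nonunits_iff, ← IsLocalRing.mem_maximalIdeal,
      ← Localization.AtPrime.map_eq_maximalIdeal]
    exact Ideal.mem_map_of_mem _ (hIP hy)
  have key := lci_northcott_local r (Localization.AtPrime P) (fun i => φ (f i)) (fun i => φ (x i))
    (σ • M.map φ) (by
      have := hf.of_flat (S := Localization.AtPrime P)
      rw [List.map_ofFn] at this
      exact this) (fun i => hm _ (hfI i)) (fun i => hm _ (hx i)) (by
      intro i
      have h1 := congrArg (fun z => σ * φ z) (hM i)
      simp only [map_mul, map_sum, Finset.mul_sum] at h1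
      rw [← mul_assoc, mul_comm σ, hσ, one_mul] at h1
      rw [h1]
      simp [mul_assoc])
  rw [hdet, lci_span_map_comp, lci_span_map_comp] at key
  constructor
  · intro w hw
    obtain ⟨c, hc⟩ := key.1 (φ w) (fun i => by
      rw [← map_mul]; exact Ideal.mem_map_of_mem _ (hw _ (hx i)))
    obtain ⟨⟨b, t⟩, hb⟩ := IsLocalization.surj P.primeCompl (c * σ ^ r)
    have h2 : φ (t * w - b * M.det) ∈ (Ideal.span (Set.range f)).map φ := by
      have : φ (t * w - b * M.det) = φ t * (φ w - c * (σ ^ r * φ M.det)) := by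
        rw [map_sub, map_mul, map_mul, ← hb]
        ring
      rw [this]
      exact Ideal.mul_mem_left _ _ hc
    obtain ⟨t', ht', h3⟩ := (lci_loc_mem_iff P _ _).1 h2
    refine ⟨t' * t, t' * b, fun h => (Ideal.IsPrime.mem_or_mem ‹_› h).elim ht' t.2, ?_⟩
    have : t' * t * w - t' * b * M.det = t' * (t * w - b * M.det) := by ring
    rw [this]; exact h3
  · intro w hw
    have h1 := key.2 (φ w) (by
      rw [mul_left_comm, ← map_mul]
      exact Ideal.mul_mem_left _ _ (Ideal.mem_map_of_mem _ hw))
    obtain ⟨t, ht, h2⟩ := (lci_loc_mem_iff P _ _).1 h1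
    refine ⟨t, ht, (Ideal.span_le.2 ?_ : _ ≤ I) h2⟩
    rintro _ ⟨i, rfl⟩
    exact hx i

end PartF

section PartG
open RingTheory.Sequence

theorem lci_coords {A : Type u} [CommRing A] [IsNoetherianRing A] (I : Ideal A) {r : ℕ}
    (P : Ideal A) [P.IsPrime] (x : Fin r → I) (s : A)
    (hs : ∀ y ∈ I, s * y ∈ Ideal.span (Set.range fun i => (x i : A)))
    (hsyz : ∀ (a : Fin r → A), ∑ j, a j * (x j : A) = 0 → ∀ i, ∃ t, t ∉ P ∧ t * a i ∈ I) :
    ∃ (t : A) (c : Fin r → (I →ₗ[A] (A ⧸ I))), t ∉ P ∧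
      ∀ i j, c i (x j) = if i = j then Ideal.Quotient.mk I (t * s) else 0 := by
  classical
  let p : (Fin r → A) →ₗ[A] A := Fintype.linearCombination A (fun i => (x i : A))
  have hp : ∀ a, p a = ∑ j, a j * (x j : A) := fun a => by
    simp [p, Fintype.linearCombination_apply]
  let N : Submodule A (Fin r → A) := Submodule.pi Set.univ (fun _ => I)
  obtain ⟨t, ht, htN⟩ := lci_uniform P N (LinearMap.ker p) (IsNoetherian.noetherian _) (by
    intro a ha
    rw [LinearMap.mem_ker, hp] at ha
    choose t ht hta using hsyz a ha
    refine ⟨∏ i, t i, ?_, ?_⟩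
    · intro h
      obtain ⟨i, _, hi⟩ := (Ideal.IsPrime.prod_mem_iff (hp := ‹P.IsPrime›)).1 h
      exact ht i hi
    · rw [Submodule.mem_pi]
      intro i _
      rw [Pi.smul_apply, smul_eq_mul, ← Finset.mul_prod_erase _ _ (Finset.mem_univ i)]
      have : t i * (∏ x ∈ Finset.univ.erase i, t x) * a i
          = (∏ x ∈ Finset.univ.erase i, t x) * (t i * a i) := by ring
      rw [this]
      exact Ideal.mul_mem_left _ _ (hta i))
  have htN' : ∀ a b : Fin r → A, p a = p b → ∀ i,
      Ideal.Quotient.mk I (t * a i) = Ideal.Quotient.mk I (t * b i) := by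
    intro a b hab i
    have h1 := htN (a - b) (by rw [LinearMap.mem_ker, map_sub, hab, sub_self])
    rw [Submodule.mem_pi] at h1
    have h2 := h1 i trivial
    rw [Ideal.Quotient.eq, ← mul_sub]
    exact h2
  have hα : ∀ y : I, ∃ a : Fin r → A, p a = s * y := by
    intro y
    obtain ⟨c, hc⟩ := Ideal.mem_span_range_iff_exists_fun.1 (hs y y.2)
    exact ⟨c, by rw [hp]; exact hc⟩
  choose α hα using hα
  let c : Fin r → (I →ₗ[A] (A ⧸ I)) := fun i =>
    { toFun := fun y => Ideal.Quotient.mk I (t * α y i)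
      map_add' := by
        intro y z
        rw [htN' (α (y + z)) (α y + α z) (by
          rw [map_add, hα, hα, hα]; push_cast; ring) i]
        simp [mul_add]
      map_smul' := by
        intro b y
        rw [htN' (α (b • y)) (b • α y) (by
          rw [map_smul, hα, hα]; simp; ring) i]
        change _ = Ideal.Quotient.mk I (b • (t * α y i))
        congr 1
        simp; ring }
  refine ⟨t, c, ht, fun i j => ?_⟩
  change Ideal.Quotient.mk I (t * α (x j) i) = _
  rw [htN' (α (x j)) (Pi.single j s) (by
    rw [hα, hp]
    simp [Pi.single_apply]) i]
  by_cases h : i = j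
  · subst h; simp
  · simp [h]

theorem lci_inj_fst {A : Type u} [CommRing A] {H Q : Type*} [AddCommGroup H] [Module A H]
    [AddCommGroup Q] [Module A Q] (Γ : Submodule A (H × Q)) (h : ∀ v, ((0 : H), v) ∈ Γ → v = 0) :
    Function.Injective (fun p : Γ => p.1.1) := by
  rintro ⟨⟨a, b⟩, hp⟩ ⟨⟨c, d⟩, hq⟩ (h1 : a = c)
  subst h1
  have h2 := Γ.sub_mem hp hq
  rw [Prod.mk_sub_mk, sub_self] at h2
  have h3 := sub_eq_zero.1 (h _ h2)
  subst h3
  rfl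

theorem lci_inj_snd {A : Type u} [CommRing A] {H Q : Type*} [AddCommGroup H] [Module A H]
    [AddCommGroup Q] [Module A Q] (Γ : Submodule A (H × Q)) (h : ∀ v, (v, (0 : Q)) ∈ Γ → v = 0) :
    Function.Injective (fun p : Γ => p.1.2) := by
  rintro ⟨⟨a, b⟩, hp⟩ ⟨⟨c, d⟩, hq⟩ (h1 : b = d)
  subst h1
  have h2 := Γ.sub_mem hp hq
  rw [Prod.mk_sub_mk, sub_self] at h2
  have h3 := sub_eq_zero.1 (h _ h2)
  subst h3
  rfl

theorem lci_glue {A : Type u} [CommRing A] [IsNoetherianRing A] (I : Ideal A) {r : ℕ}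
    (hI : LciLoc I r) (f : Fin r → A) (hf : IsWeaklyRegular A (List.ofFn f)) (hfI : ∀ i, f i ∈ I)
    (H : Type*) [AddCommGroup H] [Module A H] (ev : H →ₗ[A] ((Fin r → I) → A ⧸ I))
    (E1 : Function.Injective ev)
    (E2 : ∀ (φ : H) (s : A) (y x : Fin r → I) (N : Matrix (Fin r) (Fin r) A),
      (∀ i, s * (y i : A) = ∑ j, N i j * (x j : A)) → s ^ r • ev φ y = N.det • ev φ x)
    (E3 : ∀ c : Fin r → (I →ₗ[A] (A ⧸ I)), ∃ φ : H, ∀ y : Fin r → I,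
      ev φ y = (Matrix.of fun i j => c j (y i)).det) :
    Nonempty (H ≃ₗ[A] ((A ⧸ I) →ₗ[A] (A ⧸ Ideal.span (Set.range f)))) := by
  classical
  let J := Ideal.span (Set.range f)
  obtain ⟨one, hone⟩ : ∃ o : A ⧸ I, o = Ideal.Quotient.mk I 1 := ⟨_, rfl⟩
  have smul_mk : ∀ (L : Ideal A) (a b : A),
    a • Ideal.Quotient.mk L b = Ideal.Quotient.mk L (a * b) := fun _ _ _ => rfl
  have mk_one : ∀ a, Ideal.Quotient.mk I a = a • one := fun a => by
    rw [hone, smul_mk, mul_one]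
  have Tapp : ∀ (T : ((A ⧸ I) →ₗ[A] (A ⧸ J))) a, T (Ideal.Quotient.mk I a) = a • T one := fun T a => by
    rw [mk_one, map_smul]
  have Qext : ∀ T T' : ((A ⧸ I) →ₗ[A] (A ⧸ J)), T one = T' one → T = T' := by
    intro T T' h
    apply LinearMap.ext
    intro z
    obtain ⟨a, rfl⟩ := Ideal.Quotient.mk_surjective z
    rw [Tapp T a, Tapp T' a, h]
  have IQ : ∀ (T : ((A ⧸ I) →ₗ[A] (A ⧸ J))), ∀ y ∈ I, y • T = 0 := by
    intro T y hy
    apply Qext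
    rw [LinearMap.smul_apply, ← Tapp, Ideal.Quotient.eq_zero_iff_mem.2 hy, map_zero]; rfl
  have IH : ∀ (φ : H), ∀ y ∈ I, y • φ = 0 := by
    intro φ y hy
    apply E1
    rw [map_smul, map_zero]
    ext z
    obtain ⟨a, ha⟩ := Ideal.Quotient.mk_surjective (ev φ z)
    rw [Pi.smul_apply, ← ha, smul_mk, Pi.zero_apply, Ideal.Quotient.eq_zero_iff_mem]
    exact Ideal.mul_mem_right _ _ hy
  have Tex : ∀ w, (∀ y ∈ I, w * y ∈ J) → ∃ T : ((A ⧸ I) →ₗ[A] (A ⧸ J)), T one = Ideal.Quotient.mk J w := by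
    intro w hw
    refine ⟨Submodule.liftQ I
      (LinearMap.toSpanSingleton A _ (Ideal.Quotient.mk J w)) ?_, ?_⟩
    · intro y hy
      rw [LinearMap.mem_ker, LinearMap.toSpanSingleton_apply, smul_mk,
        Ideal.Quotient.eq_zero_iff_mem, mul_comm]
      exact hw y hy
    · rw [hone]; exact (Submodule.liftQ_apply _ _ _).trans (one_smul A _)
  let Ch : (Fin r → I) → A → Matrix (Fin r) (Fin r) A → Prop := fun x s M =>
    (∀ y ∈ I, s * y ∈ Ideal.span (Set.range fun i => (x i : A))) ∧
    (∀ i, s * f i = ∑ j, M i j * (x j : A))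
  have hdet : ∀ x s M, Ch x s M → ∀ y ∈ I, s * M.det * y ∈ J := by
    intro x s M h y hy
    have h1 := lci_cramer M (fun i => (x i : A)) (fun i => s * f i) h.2 J
      (fun i => J.mul_mem_left _ (Ideal.subset_span ⟨i, rfl⟩))
    have h2 := lci_mul_span _ J M.det _ h1 (h.1 y hy)
    have : s * M.det * y = M.det * (s * y) := by ring
    rw [this]; exact h2
  let Γ : Submodule A (H × ((A ⧸ I) →ₗ[A] (A ⧸ J))) :=
    { carrier := {p | ∀ x s M (T : ((A ⧸ I) →ₗ[A] (A ⧸ J))), Ch x s M → T one = Ideal.Quotient.mk J (s * M.det) →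
        s ^ (r + 1) • p.2 one = T (ev p.1 x)}
      add_mem' := by
        intro p q hp hq x s M T h hT
        have h1 := hp x s M T h hT
        have h2 := hq x s M T h hT
        rw [Prod.snd_add, LinearMap.add_apply, smul_add, h1, h2, Prod.fst_add, map_add,
          Pi.add_apply, map_add]
      zero_mem' := by
        intro x s M T h hT
        change s ^ (r + 1) • (0 : A ⧸ J) = T (ev 0 x)
        rw [map_zero, Pi.zero_apply, map_zero, smul_zero]
      smul_mem' := by
        intro b p hp x s M T h hT
        have h1 := hp x s M T h hT
        rw [Prod.smul_snd, LinearMap.smul_apply, smul_comm, h1, Prod.smul_fst, map_smul,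
          Pi.smul_apply, map_smul] }
  have hΓ : ∀ x s M (T : ((A ⧸ I) →ₗ[A] (A ⧸ J))), Ch x s M → T one = Ideal.Quotient.mk J (s * M.det) →
      ∀ (φ : H) (a : A), Ideal.Quotient.mk I a = ev φ x → (s ^ (r + 1) • φ, a • T) ∈ Γ := by
    intro x s M T h hT φ a ha x' s' M' T' h' hT'
    obtain ⟨a', ha'⟩ := Ideal.Quotient.mk_surjective (ev φ x')
    have hN : ∀ i, ∃ n : Fin r → A, ∑ j, n j * (x' j : A) = s' * (x i : A) := fun i =>
      Ideal.mem_span_range_iff_exists_fun.1 (h'.1 (x i) (x i).2)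
    choose N hN using hN
    have e2 := E2 φ s' x x' (Matrix.of N) (fun i => (hN i).symm)
    rw [← ha, ← ha', smul_mk, smul_mk, Ideal.Quotient.eq] at e2
    have h1 := hdet x s M h _ e2
    have h2 := lci_indep f hf (s • M') (M * Matrix.of N) (fun i => (x' i : A)) (s * s') s'
      (fun i => by
        simp only [Matrix.smul_apply, smul_eq_mul, mul_assoc, ← Finset.mul_sum]
        rw [h'.2])
      (fun i => by
        have h3 : ∑ j, (M * Matrix.of N) i j * (x' j : A) = s' * ∑ k, M i k * (x k : A) := by
          simp only [Matrix.mul_apply, Finset.sum_mul, Finset.mul_sum, Matrix.of_apply]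
          rw [Finset.sum_comm]
          refine Finset.sum_congr rfl fun k _ => ?_
          rw [mul_left_comm, ← hN, Finset.mul_sum]
          refine Finset.sum_congr rfl fun j _ => ?_
          ring
        rw [h3, ← h.2]; ring)
      (fun i => h'.1 _ (hfI i))
    rw [Matrix.det_mul, Matrix.det_smul, Fintype.card_fin] at h2
    change s' ^ (r + 1) • (a • T one) = T' (ev (s ^ (r + 1) • φ) x')
    rw [map_smul, Pi.smul_apply, map_smul, ← ha', Tapp T' a', hT, hT', smul_mk, smul_mk, smul_mk, smul_mk,
      Ideal.Quotient.eq]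
    have : s' ^ (r + 1) * (a * (s * M.det)) - s ^ (r + 1) * (a' * (s' * M'.det)) =
        s' * (s * M.det * (s' ^ r * a - (Matrix.of N).det * a')) +
        s * a' * (s' * (M.det * (Matrix.of N).det - s ^ r * M'.det)) := by ring
    rw [this]
    exact add_mem (J.mul_mem_left _ h1) (J.mul_mem_left _ h2)
  have hchart : ∀ P : Ideal A, P.IsPrime → I ≤ P → ∃ x s M, ∃ T : ((A ⧸ I) →ₗ[A] (A ⧸ J)), s ∉ P ∧ Ch x s M ∧
      T one = Ideal.Quotient.mk J (s * M.det) ∧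
      ∀ (a : Fin r → A), ∑ j, a j * (x j : A) = 0 → ∀ i, ∃ t, t ∉ P ∧ t * a i ∈ I := by
    intro P hP hIP
    obtain ⟨x, s, hs, hxI, hsI, hsyz⟩ := lci_chart I r hI P hIP
    have hM : ∀ i, ∃ m : Fin r → A, ∑ j, m j * x j = s * f i := fun i =>
      Ideal.mem_span_range_iff_exists_fun.1 (hsI (f i) (hfI i))
    choose M hM using hM
    have hC : Ch (fun i => ⟨x i, hxI i⟩) s (Matrix.of M) := ⟨hsI, fun i => (hM i).symm⟩
    obtain ⟨T, hT⟩ := Tex _ (hdet _ _ _ hC)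
    exact ⟨_, s, _, T, hs, hC, hT, hsyz⟩
  have mulnot : ∀ P : Ideal A, P.IsPrime → ∀ a b, a ∉ P → b ∉ P → a * b ∉ P := by
    intro P hP a b ha hb h
    exact (hP.mem_or_mem h).elim ha hb
  have pownot : ∀ P : Ideal A, P.IsPrime → ∀ a (n : ℕ), a ∉ P → a ^ n ∉ P := by
    intro P hP a n ha h
    exact ha (hP.mem_of_pow_mem n h)
  let π₁ : Γ →ₗ[A] H := (LinearMap.fst A H ((A ⧸ I) →ₗ[A] (A ⧸ J))).comp Γ.subtype
  let π₂ : Γ →ₗ[A] ((A ⧸ I) →ₗ[A] (A ⧸ J)) := (LinearMap.snd A H ((A ⧸ I) →ₗ[A] (A ⧸ J))).comp Γ.subtype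
  have inj1 : Function.Injective π₁ := by
    refine lci_inj_fst Γ ?_
    intro v hp
    have : v ∈ (⊥ : Submodule A ((A ⧸ I) →ₗ[A] (A ⧸ J))) := by
      refine lci_local_mem I _ v (fun y hy => by rw [IQ v y hy]; exact zero_mem _) ?_
      intro P hP hIP
      obtain ⟨x, s, M, T, hs, hC, hT, _⟩ := hchart P hP hIP
      have h1 := hp x s M T hC hT
      refine ⟨s ^ (r + 1), pownot P hP _ _ hs, ?_⟩
      rw [Submodule.mem_bot]
      apply Qext
      rw [LinearMap.smul_apply, h1]
      simp
    exact (Submodule.mem_bot A).1 this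
  have inj2 : Function.Injective π₂ := by
    refine lci_inj_snd Γ ?_
    intro φ hp
    have : φ ∈ (⊥ : Submodule A H) := by
      refine lci_local_mem I _ φ (fun y hy => by rw [IH φ y hy]; exact zero_mem _) ?_
      intro P hP hIP
      obtain ⟨x, s, M, T, hs, hC, hT, _⟩ := hchart P hP hIP
      have h1 := hp x s M T hC hT
      obtain ⟨a, ha⟩ := Ideal.Quotient.mk_surjective (ev φ x)
      change _ = T (ev φ x) at h1
      rw [← ha, Tapp, hT, smul_mk] at h1
      rw [LinearMap.zero_apply, smul_zero, eq_comm, Ideal.Quotient.eq_zero_iff_mem, ← mul_assoc] at h1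
      obtain ⟨t, ht, hta⟩ := (lci_northcott I f hf hfI P hIP (fun i => (x i : A)) (fun i => (x i).2)
        s hs M hC.2).2 _ h1
      refine ⟨t * s * s ^ r, mulnot P hP _ _ (mulnot P hP _ _ ht hs) (pownot P hP _ _ hs), ?_⟩
      rw [Submodule.mem_bot]
      apply E1
      rw [map_smul, map_zero]
      ext y
      have hN : ∀ i, ∃ n : Fin r → A, ∑ j, n j * (x j : A) = s * (y i : A) := fun i =>
        Ideal.mem_span_range_iff_exists_fun.1 (hC.1 (y i) (y i).2)
      choose N hN using hN
      have e2 := E2 φ s y x (Matrix.of N) (fun i => (hN i).symm)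
      rw [Pi.smul_apply, mul_smul, e2, ← ha, smul_mk, smul_mk, Pi.zero_apply,
        Ideal.Quotient.eq_zero_iff_mem]
      have : t * s * ((Matrix.of N).det * a) = (Matrix.of N).det * (t * (a * s)) := by ring
      rw [this]
      exact I.mul_mem_left _ hta
    exact (Submodule.mem_bot A).1 this
  have sur1 : Function.Surjective π₁ := by
    rw [← LinearMap.range_eq_top, eq_top_iff]
    intro φ _
    refine lci_local_mem I _ φ (fun y hy => by rw [IH φ y hy]; exact zero_mem _) ?_
    intro P hP hIP
    obtain ⟨x, s, M, T, hs, hC, hT, _⟩ := hchart P hP hIP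
    obtain ⟨a, ha⟩ := Ideal.Quotient.mk_surjective (ev φ x)
    exact ⟨s ^ (r + 1), pownot P hP _ _ hs, ⟨⟨_, hΓ x s M T hC hT φ a ha⟩, rfl⟩⟩
  have sur2 : Function.Surjective π₂ := by
    rw [← LinearMap.range_eq_top, eq_top_iff]
    intro v _
    refine lci_local_mem I _ v (fun y hy => by rw [IQ v y hy]; exact zero_mem _) ?_
    intro P hP hIP
    obtain ⟨x, s, M, T, hs, hC, hT, hsyz⟩ := hchart P hP hIP
    obtain ⟨w, hw⟩ := Ideal.Quotient.mk_surjective (v one)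
    obtain ⟨t, c, ht, htc⟩ := (lci_northcott I f hf hfI P hIP (fun i => (x i : A))
      (fun i => (x i).2) s hs M hC.2).1 w (by
        intro y hy
        have : y • v one = 0 := congrArg (fun z : ((A ⧸ I) →ₗ[A] (A ⧸ J)) => z one) (IQ v y hy)
        rw [← hw, smul_mk, Ideal.Quotient.eq_zero_iff_mem, mul_comm] at this
        exact this)
    obtain ⟨t', co, ht', hco⟩ := lci_coords I P x s hC.1 hsyz
    obtain ⟨φ, hφ⟩ := E3 co
    have ha : Ideal.Quotient.mk I ((t' * s) ^ r) = ev φ x := by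
      rw [hφ]
      have : (Matrix.of fun i j => co j (x i)) =
          Matrix.diagonal (fun _ : Fin r => Ideal.Quotient.mk I (t' * s)) := by
        ext i j
        rw [Matrix.of_apply, hco, Matrix.diagonal_apply]
        by_cases hij : i = j
        · subst hij; simp
        · simp [hij, Ne.symm hij]
      rw [this, Matrix.det_diagonal]
      simp
    have hmem := hΓ x s M T hC hT φ _ ha
    have hmem2 := Γ.smul_mem c hmem
    refine ⟨(t' * s) ^ r * s * t, mulnot P hP _ _ (mulnot P hP _ _
      (pownot P hP _ _ (mulnot P hP _ _ ht' hs)) hs) ht, ⟨⟨_, hmem2⟩, ?_⟩⟩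
    change c • ((t' * s) ^ r • T) = _
    apply Qext
    rw [LinearMap.smul_apply, LinearMap.smul_apply, LinearMap.smul_apply, hT, ← hw, smul_mk, smul_mk,
      smul_mk, Ideal.Quotient.eq]
    have : c * ((t' * s) ^ r * (s * M.det)) - (t' * s) ^ r * s * t * w =
      - ((t' * s) ^ r * s) * (t * w - c * M.det) := by ring
    rw [this]
    exact J.mul_mem_left _ htc
  exact ⟨(LinearEquiv.ofBijective π₁ ⟨inj1, sur1⟩).symm.trans
    (LinearEquiv.ofBijective π₂ ⟨inj2, sur2⟩)⟩

end PartG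

section PartH
open RingTheory.Sequence

theorem lci_alt_det {R : Type*} [CommRing R] {M : Type*} [AddCommGroup M] [Module R M] {r : ℕ}
    (g : M [⋀^Fin r]→ₗ[R] R) (s : R) (y x : Fin r → M) (N : Matrix (Fin r) (Fin r) R)
    (h : ∀ i, s • y i = ∑ j, N i j • x j) : s ^ r * g y = N.det * g x := by
  classical
  have h1 := AlternatingMap.eq_smul_basis_det (Pi.basisFun R (Fin r))
    (g.compLinearMap (Fintype.linearCombination R x))
  have h2 := congrArg (fun k => k N) h1
  have h3 : (g.compLinearMap (Fintype.linearCombination R x)) N = s ^ r * g y := by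
    have h4 := g.map_smul_univ (fun _ => s) y
    rw [Finset.prod_const, Finset.card_univ, Fintype.card_fin, smul_eq_mul] at h4
    rw [← h4]
    change g _ = _
    congr 1
    ext i
    rw [h i]
    simp [Fintype.linearCombination_apply]
  have h5 : (g.compLinearMap (Fintype.linearCombination R x)) (Pi.basisFun R (Fin r)) = g x := by
    change g _ = _
    congr 1
    ext i
    simp [Fintype.linearCombination_apply, Pi.single_apply]
  have h6 : (Pi.basisFun R (Fin r)).det N = N.det := by
    rw [Pi.basisFun_det]; rfl
  rw [← h3]
  refine h2.trans ?_
  change (g.compLinearMap (Fintype.linearCombination R x)) (Pi.basisFun R (Fin r)) *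
    (Pi.basisFun R (Fin r)).det N = _
  rw [h5, h6, mul_comm]

theorem lci_main {A : Type u} [CommRing A] [IsNoetherianRing A] (I : Ideal A) {r : ℕ}
    (hI : LciLoc I r) (f : Fin r → A) (hf : IsWeaklyRegular A (List.ofFn f)) (hfI : ∀ i, f i ∈ I) :
    Nonempty (RestrictScalars A (A ⧸ I) (Module.Dual (A ⧸ I) (⋀[A ⧸ I]^r I.Cotangent)) ≃ₗ[A]
      ((A ⧸ I) →ₗ[A] (A ⧸ Ideal.span (Set.range f)))) := by
  classical
  let ev : RestrictScalars A (A ⧸ I) (Module.Dual (A ⧸ I) (⋀[A ⧸ I]^r I.Cotangent)) →ₗ[A]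
      ((Fin r → I) → A ⧸ I) :=
    { toFun := fun φ y => (RestrictScalars.addEquiv A (A ⧸ I) _ φ)
        (exteriorPower.ιMulti (A ⧸ I) r (fun i => I.toCotangent (y i)))
      map_add' := fun φ ψ => by
        ext y
        rw [map_add]; rfl
      map_smul' := fun a φ => by
        ext y
        rw [RestrictScalars.addEquiv_map_smul]
        simp only [LinearMap.smul_apply, RingHom.id_apply, Pi.smul_apply, algebraMap_smul] }
  have tosurj : Function.Surjective I.toCotangent := I.toCotangent_surjective
  have hev : ∀ φ y, ev φ y = (RestrictScalars.addEquiv A (A ⧸ I) _ φ)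
        (exteriorPower.ιMulti (A ⧸ I) r (fun i => I.toCotangent (y i))) := fun _ _ => rfl
  have E1 : Function.Injective ev := by
    intro φ ψ h
    apply (RestrictScalars.addEquiv A (A ⧸ I) _).injective
    apply exteriorPower.linearMap_ext
    ext m
    choose y hy using fun i => tosurj (m i)
    obtain rfl : (fun i => I.toCotangent (y i)) = m := funext hy
    exact congrFun h y
  have E2 : ∀ (φ : RestrictScalars A (A ⧸ I) (Module.Dual (A ⧸ I) (⋀[A ⧸ I]^r I.Cotangent)))
      (s : A) (y x : Fin r → I) (N : Matrix (Fin r) (Fin r) A),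
      (∀ i, s * (y i : A) = ∑ j, N i j * (x j : A)) → s ^ r • ev φ y = N.det • ev φ x := by
    intro φ s y x N h
    have := lci_alt_det (R := A ⧸ I) ((RestrictScalars.addEquiv A (A ⧸ I) _ φ).compAlternatingMap
      (exteriorPower.ιMulti (A ⧸ I) r)) (Ideal.Quotient.mk I s) (fun i => I.toCotangent (y i))
      (fun i => I.toCotangent (x i)) (N.map (Ideal.Quotient.mk I)) (by
        intro i
        have h1 : s • y i = ∑ j, N i j • x j := by
          apply Subtype.ext
          simpa using h i
        have h2 := congrArg I.toCotangent h1
        rw [map_smul, map_sum] at h2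
        simp only [map_smul] at h2
        exact h2)
    rw [hev, hev, Algebra.smul_def, Algebra.smul_def, map_pow]
    refine this.trans ?_
    congr 1
    exact ((Ideal.Quotient.mk I).map_det N).symm
  have E3 : ∀ c : Fin r → (I →ₗ[A] (A ⧸ I)),
      ∃ φ : RestrictScalars A (A ⧸ I) (Module.Dual (A ⧸ I) (⋀[A ⧸ I]^r I.Cotangent)),
      ∀ y : Fin r → I, ev φ y = (Matrix.of fun i j => c j (y i)).det := by
    intro c
    have hc : ∀ j, (I • ⊤ : Submodule A I) ≤ LinearMap.ker (c j) := by
      intro j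
      rw [Submodule.smul_le]
      intro a ha n _
      obtain ⟨b, hb⟩ := Ideal.Quotient.mk_surjective (c j n)
      rw [LinearMap.mem_ker, map_smul, ← hb]
      change Ideal.Quotient.mk I (a * b) = 0
      rw [Ideal.Quotient.eq_zero_iff_mem]
      exact I.mul_mem_right _ ha
    let cb : Fin r → (I.Cotangent →ₗ[A] (A ⧸ I)) := fun j => Submodule.liftQ _ (c j) (hc j)
    have hcb : ∀ j y, cb j (I.toCotangent y) = c j y := fun j y => Submodule.liftQ_apply _ _ _
    let cq : Fin r → (I.Cotangent →ₗ[A ⧸ I] (A ⧸ I)) := fun j =>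
      LinearMap.extendScalarsOfSurjective Ideal.Quotient.mk_surjective (cb j)
    refine ⟨(RestrictScalars.addEquiv A (A ⧸ I) _).symm (exteriorPower.alternatingMapLinearEquiv
      (Matrix.detRowAlternating.compLinearMap (LinearMap.pi cq))), fun y => ?_⟩
    rw [hev, AddEquiv.apply_symm_apply, exteriorPower.alternatingMapLinearEquiv_apply_ιMulti]
    change Matrix.det _ = Matrix.det _
    congr 1
  let m2 := RestrictScalars.module A (A ⧸ I) (Module.Dual (A ⧸ I) (⋀[A ⧸ I]^r I.Cotangent))
  exact @lci_glue A _ _ I r hI f hf hfI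
    (RestrictScalars A (A ⧸ I) (Module.Dual (A ⧸ I) (⋀[A ⧸ I]^r I.Cotangent)))
    (inferInstanceAs (AddCommGroup (Module.Dual (A ⧸ I) (⋀[A ⧸ I]^r I.Cotangent))))
    m2 ev E1 E2 E3
end PartH

end LciHelpers

/-- For a local complete intersection ideal `I` of height `r` in a Noetherian
ring `A`, there is an isomorphism
`Ext^r_A(A/I, A) ≅ Hom_{A/I}(Λ^r(I/I²), A/I)` (an isomorphism of `A`-modules,
the right-hand side being an `A/I`-module viewed over `A` by restriction of
scalars). -/
theorem ext_of_lci_iso_dual_of_top_exterior_power_of_conormal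
    {A : Type u} [CommRing A] [IsNoetherianRing A]
    (I : Ideal A) (r : ℕ) (hI : IsLocalCompleteIntersectionOfHeight I r) :
    Nonempty ((((Ext A (ModuleCat.{u} A) r).obj
        (Opposite.op (ModuleCat.of A (A ⧸ I)))).obj (ModuleCat.of A A)) ≃ₗ[A]
      RestrictScalars A (A ⧸ I)
        (Module.Dual (A ⧸ I) (⋀[A ⧸ I]^r I.Cotangent))) := by
  obtain ⟨l, hl, hreg, hlI⟩ := lci_exists_list I r hI.2 r le_rfl
  subst hl
  have hf : RingTheory.Sequence.IsWeaklyRegular A (List.ofFn l.get) := by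
    rw [List.ofFn_get]; exact hreg
  have hfI : ∀ i, l.get i ∈ I := fun i => hlI _ (List.get_mem l i)
  obtain ⟨e⟩ := lci_ext_iso I l.get hf hfI
  obtain ⟨e'⟩ := lci_main I hI.2 l.get hf hfI
  exact ⟨e.trans e'.symm⟩
end
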